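/- arXiv:math/0202038 — 2 statements merged into one kernel-verified Lean document; each statement's English description precedes it below -/
import Mathlib

section
/- Let n ≥ 3 and suppose the hypersurface h = 0 has isolated singularities. Let {-,-} be a Poisson bracket on O = A/(h). Then for every prime ideal P of O there exists a family p : Fin n → Fin n → Fin n → A_{P'} which is alternating under permutations of its three indices (permuting the indices multiplies the value by the sign of the permutation), such that for all F, G ∈ A one has loc({[F],[G]}) = Σ_{i,j,k} p i j k • loc([∂ᵢF · ∂ⱼG · ∂ₖh]) in O_P, where • denotes the A_{P'}-module action on O_P. -/
open MvPolynomial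

/-- A Poisson bracket on a commutative `ℂ`-algebra `R`: a `ℂ`-bilinear map which is
antisymmetric, a derivation in each argument, and satisfies the Jacobi identity. -/
def IsPoissonBracket {R : Type*} [CommRing R] [Algebra ℂ R] (br : R → R → R) : Prop :=
  (∀ (c : ℂ) (f g k : R), br (c • f + g) k = c • br f k + br g k) ∧
  (∀ (c : ℂ) (f g k : R), br f (c • g + k) = c • br f g + br f k) ∧
  (∀ f g : R, br f g = - br g f) ∧
  (∀ f g k : R, br f (g * k) = br f g * k + g * br f k) ∧
  (∀ f g k : R, br (f * g) k = br f k * g + f * br g k) ∧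
  (∀ f g k : R, br f (br g k) + br g (br k f) + br k (br f g) = 0)

namespace AlternatingMap

variable {R V M N : Type*} [CommRing R] [AddCommGroup V] [Module R V]
  [AddCommGroup M] [Module R M] [AddCommGroup N] [Module R N]

/-- The wedge product of a linear form with an alternating map. -/
noncomputable def wedgeLeft {q : ℕ} (ε : V →ₗ[R] R) (c : V [⋀^Fin q]→ₗ[R] M) :
    V [⋀^Fin (q + 1)]→ₗ[R] M :=
  alternatizeUncurryFin (ε.smulRight c)

theorem wedgeLeft_apply {q : ℕ} (ε : V →ₗ[R] R) (c : V [⋀^Fin q]→ₗ[R] M) (v : Fin (q + 1) → V) :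
    wedgeLeft ε c v = ∑ i : Fin (q + 1), (-1) ^ (i : ℕ) • ε (v i) • c (i.removeNth v) := by
  simp [wedgeLeft, alternatizeUncurryFin_apply]

theorem curryLeft_wedgeLeft {q : ℕ} (ε : V →ₗ[R] R) (c : V [⋀^Fin (q + 1)]→ₗ[R] M) (a : V) :
    (wedgeLeft ε c).curryLeft a = ε a • c - wedgeLeft ε (c.curryLeft a) := by
  ext v
  have key (i : Fin (q + 1)) :
      i.succ.removeNth (Matrix.vecCons a v) = Matrix.vecCons a (i.removeNth v) := by
    ext j
    refine Fin.cases ?_ (fun j => ?_) j <;> simp [Fin.removeNth_apply, Matrix.vecCons]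
  have key0 : Fin.removeNth 0 (Matrix.vecCons a v) = v := by
    ext j
    simp [Fin.removeNth_apply, Matrix.vecCons]
  rw [curryLeft_apply_apply, wedgeLeft_apply, Fin.sum_univ_succ, sub_apply, wedgeLeft_apply,
    sub_eq_add_neg, ← Finset.sum_neg_distrib]
  simp [key, key0, pow_succ]

theorem eq_zero_of_card_lt {ι : Type*} [Fintype ι] (b : Module.Basis ι R V) {q : ℕ}
    (hq : Fintype.card ι < q) (c : V [⋀^Fin q]→ₗ[R] M) : c = 0 := by
  refine b.ext_alternating fun v hv => ?_
  have := Fintype.card_le_of_injective v hv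
  simp at this
  omega

theorem exists_compAlternatingMap_eq [Module.Free R V] {q : ℕ} {f : M →ₗ[R] N}
    (hf : Function.Surjective f) (c : V [⋀^Fin q]→ₗ[R] N) :
    ∃ d : V [⋀^Fin q]→ₗ[R] M, f.compAlternatingMap d = c := by
  obtain ⟨l, hl⟩ := Module.projective_lifting_property f
    (exteriorPower.alternatingMapLinearEquiv c) hf
  refine ⟨l.compAlternatingMap (exteriorPower.ιMulti R q), ?_⟩
  ext v
  simpa using congr($hl (exteriorPower.ιMulti R q v))

theorem exists_smul_eq {s : R} (hs : IsSMulRegular M s) {q : ℕ} (c : V [⋀^Fin q]→ₗ[R] M)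
    (hc : ∀ v, ∃ m, c v = s • m) : ∃ e : V [⋀^Fin q]→ₗ[R] M, s • e = c := by
  let l := LinearEquiv.ofInjective (LinearMap.lsmul R M s) hs
  refine ⟨l.symm.toLinearMap.compAlternatingMap
    (c.codRestrict _ fun v => (hc v).imp fun m hm => hm.symm), ?_⟩
  ext v
  exact congr_arg Subtype.val (l.apply_symm_apply
    ⟨c v, (hc v).imp fun m hm => hm.symm⟩)

/-- Depth sensitivity of the Koszul complex: contraction with `a` is exact in high degrees if the
ideal of values of linear forms at `a` contains a long weakly regular sequence. -/
theorem exists_curryLeft_eq {ι : Type*} [Fintype ι] (b : Module.Basis ι R V) (a : V)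
    (rs : List R) (hmem : ∀ s ∈ rs, ∃ ε : V →ₗ[R] R, ε a = s)
    (hreg : RingTheory.Sequence.IsWeaklyRegular M rs) {q : ℕ}
    (hq : Fintype.card ι < q + 1 + rs.length) (c : V [⋀^Fin (q + 1)]→ₗ[R] M)
    (hc : c.curryLeft a = 0) : ∃ e : V [⋀^Fin (q + 2)]→ₗ[R] M, e.curryLeft a = c := by
  have := Module.Free.of_basis b
  induction rs generalizing M q with
  | nil => exact ⟨0, by simp [eq_zero_of_card_lt b (by simpa using hq) c]⟩
  | cons s rs ih =>
    obtain ⟨hs, hreg⟩ := (RingTheory.Sequence.isWeaklyRegular_cons_iff M s rs).mp hreg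
    obtain ⟨ε, rfl⟩ := hmem s (by simp)
    set π : M →ₗ[R] QuotSMulTop (ε a) M := Submodule.mkQ _
    have hw : (wedgeLeft ε c).curryLeft a = ε a • c := by
      rw [curryLeft_wedgeLeft, hc]
      ext v
      simp [wedgeLeft_apply]
    have hπs (m : M) : π (ε a • m) = 0 :=
      (Submodule.Quotient.mk_eq_zero _).mpr (Submodule.smul_mem_pointwise_smul _ _ _ trivial)
    obtain ⟨u, hu⟩ := ih (fun s h => hmem s (by simp [h])) hreg (q := q + 1)
      (by simp at hq; omega) (π.compAlternatingMap (wedgeLeft ε c)) (by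
        rw [curryLeft_compAlternatingMap, hw]
        ext v
        simpa using hπs (c v))
    obtain ⟨u, rfl⟩ := exists_compAlternatingMap_eq (Submodule.mkQ_surjective _) u
    obtain ⟨e, he⟩ := exists_smul_eq hs (wedgeLeft ε c - u.curryLeft a) (fun v => by
      have h1 : π (wedgeLeft ε c v - u.curryLeft a v) = 0 := by
        rw [map_sub, sub_eq_zero]
        exact congr($hu v).symm
      obtain ⟨m, -, hm⟩ := (Submodule.mem_smul_pointwise_iff_exists _ _ _).mp
        ((Submodule.Quotient.mk_eq_zero _).mp h1)
      exact ⟨m, by simpa using hm.symm⟩)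
    refine ⟨e, ?_⟩
    ext v
    apply hs
    have h2 := congr($he (Matrix.vecCons a v))
    have h3 := congr($hw v)
    have h4 := congr($(u.curryLeft_same a) v)
    simp only [curryLeft_apply_apply, smul_apply, sub_apply, zero_apply] at h2 h3 h4 ⊢
    rw [h2, h3, h4, sub_zero]

theorem exists_dvd_sub_of_dvd {n : ℕ} [IsDomain R] {h : R} (hh : h ≠ 0) (d : Fin n → R)
    (rs : List R) (hlen : rs.length = n) (hmem : ∀ s ∈ rs, s ∈ Ideal.span (insert h (Set.range d)))
    (hreg : RingTheory.Sequence.IsWeaklyRegular R rs)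
    (B : (Fin n → R) [⋀^Fin 2]→ₗ[R] R) (hB : ∀ v, h ∣ B ![d, v]) :
    ∃ e : (Fin n → R) [⋀^Fin 3]→ₗ[R] R, ∀ v w, h ∣ B ![v, w] - e ![v, w, d] := by
  have hs : IsSMulRegular R h := IsSMulRegular.of_ne_zero hh
  let a : Fin (n + 1) → R := Fin.cons h d
  let τ : (Fin (n + 1) → R) →ₗ[R] Fin n → R := LinearMap.funLeft R R Fin.succ
  let ε₀ : (Fin (n + 1) → R) →ₗ[R] R := LinearMap.proj 0
  let σ : (Fin n → R) →ₗ[R] Fin (n + 1) → R :=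
    LinearMap.pi (Fin.cons 0 fun i => LinearMap.proj i)
  have hσ0 (v) : σ v 0 = 0 := rfl
  have hσs (v) (i : Fin n) : σ v i.succ = v i := rfl
  have hτσ (v) : τ (σ v) = v := rfl
  have hτa : τ a = d := rfl
  have ha : a = h • Pi.single 0 1 + σ d := by
    ext i
    refine Fin.cases ?_ (fun i => ?_) i <;> simp [a, hσ0, hσs]
  have hmem' (s) (hsrs : s ∈ rs) : ∃ ε : (Fin (n + 1) → R) →ₗ[R] R, ε a = s := by
    have h1 := hmem s hsrs
    rw [← Fin.range_cons, Ideal.span, Submodule.mem_span_range_iff_exists_fun] at h1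
    obtain ⟨c, hc⟩ := h1
    exact ⟨∑ i, c i • LinearMap.proj i, by simpa [LinearMap.sum_apply] using hc⟩
  obtain ⟨g, hg⟩ := exists_smul_eq hs (B.curryLeft d) (fun v => by
    obtain ⟨m, hm⟩ := hB (v 0)
    refine ⟨m, ?_⟩
    rw [smul_eq_mul, ← hm, curryLeft_apply_apply]
    congr 1
    ext i : 1
    fin_cases i <;> rfl)
  have hgd : g.curryLeft d = 0 := by
    ext v
    apply hs
    have h1 := congr($hg (Matrix.vecCons d v))
    have h2 := congr($(B.curryLeft_same d) v)
    exact (h1.trans h2).trans (smul_zero h).symm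
  obtain ⟨e, he⟩ := exists_curryLeft_eq (Pi.basisFun R (Fin (n + 1))) a rs hmem' hreg (q := 1)
    (by simp; omega) (B.compLinearMap τ - wedgeLeft ε₀ (g.compLinearMap τ)) (by
      have h1 : (wedgeLeft ε₀ (g.compLinearMap τ)).curryLeft a =
          (B.compLinearMap τ).curryLeft a := by
        rw [curryLeft_wedgeLeft, curryLeft_compLinearMap, curryLeft_compLinearMap, hτa, hgd, ← hg]
        ext v
        simp [wedgeLeft_apply, ε₀, a]
      rw [← curryLeftLinearMap_apply] at h1 ⊢
      rw [map_sub, LinearMap.sub_apply, h1]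
      exact sub_self _)
  have hmain (v w) : B ![v, w] = h * e ![Pi.single 0 1, σ v, σ w] + e ![σ d, σ v, σ w] := by
    have h1 := congr($he ![σ v, σ w])
    rw [ha, map_add, map_smul] at h1
    have h2 : wedgeLeft ε₀ (g.compLinearMap τ) ![σ v, σ w] = 0 := by
      simp [wedgeLeft_apply, Fin.sum_univ_two, ε₀, hσ0]
    have h3 : B.compLinearMap τ ![σ v, σ w] = B ![v, w] := by
      rw [compLinearMap_apply]
      congr 1
      ext i : 1
      fin_cases i <;> rfl
    rw [sub_apply, h2, h3, sub_zero] at h1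
    exact h1.symm
  refine ⟨e.compLinearMap σ, fun v w => ⟨e ![Pi.single 0 1, σ v, σ w], ?_⟩⟩
  have hrot : e.compLinearMap σ ![v, w, d] = e ![σ d, σ v, σ w] := by
    have h1 := e.map_perm ![σ d, σ v, σ w] (finRotate 3)
    rw [sign_finRotate] at h1
    simp at h1
    rw [← h1, compLinearMap_apply]
    congr 1
    ext i : 1
    fin_cases i <;> rfl
  rw [hmain, hrot]
  ring

theorem exists_map_apply_eq_sum {S ι : Type*} [CommRing S] [Fintype ι] [Invertible (2 : R)]
    {φ : R →+* S} (hφ : Function.Surjective φ) (b : ι → ι → S) (hb : ∀ i j, b i j = -b j i) :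
    ∃ B : (ι → R) [⋀^Fin 2]→ₗ[R] R, ∀ v w,
      φ (B ![v, w]) = ∑ i, ∑ j, φ (v i) * φ (w j) * b i j := by
  choose β hβ using fun i j => hφ (b i j)
  refine ⟨∑ i, ∑ j, (⅟2 * β i j) • wedgeLeft (LinearMap.proj i)
    (ofSubsingleton R (ι → R) R (0 : Fin 1) (LinearMap.proj j)), fun v w => ?_⟩
  have h2 : φ ⅟2 + φ ⅟2 = 1 := by
    rw [← map_add, ← two_mul, mul_invOf_self, map_one]
  have h1 : φ ((∑ i, ∑ j, (⅟2 * β i j) • wedgeLeft (LinearMap.proj i)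
      (ofSubsingleton R (ι → R) R (0 : Fin 1) (LinearMap.proj j))) ![v, w]) =
      (∑ i, ∑ j, φ ⅟2 * φ (v i) * φ (w j) * b i j) -
        ∑ i, ∑ j, φ ⅟2 * φ (w i) * φ (v j) * b i j := by
    let ev : ((ι → R) [⋀^Fin 2]→ₗ[R] R) →+ R :=
      { toFun := fun f => f ![v, w], map_zero' := rfl, map_add' := fun _ _ => rfl }
    have hev (f) : ev f = f ![v, w] := rfl
    rw [← hev, map_sum, map_sum]
    simp only [map_sum ev, map_sum φ]
    simp only [hev, smul_apply, wedgeLeft_apply, ← Finset.sum_sub_distrib]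
    refine Finset.sum_congr rfl fun i _ => Finset.sum_congr rfl fun j _ => ?_
    simp [Fin.removeNth_apply, hβ]
    ring
  rw [h1, Finset.sum_comm (f := fun i j => φ ⅟2 * φ (w i) * φ (v j) * b i j)]
  simp only [← Finset.sum_sub_distrib]
  refine Finset.sum_congr rfl fun i _ => Finset.sum_congr rfl fun j _ => ?_
  rw [hb j i]
  linear_combination (φ (v i) * φ (w j) * b i j) * h2

end AlternatingMap

section RegularSequences

open RingTheory.Sequence

theorem Polynomial.mem_map_C_of_monic_mul_mem {B : Type*} [CommRing B] (J : Ideal B)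
    {f g : Polynomial B} (hf : f.Monic) (h : f * g ∈ J.map Polynomial.C) :
    g ∈ J.map Polynomial.C := by
  rw [← Ideal.mk_ker (I := J), ← Polynomial.ker_mapRingHom, RingHom.mem_ker,
    Polynomial.coe_mapRingHom] at h ⊢
  rw [Polynomial.map_mul] at h
  exact (hf.map _).mul_right_eq_zero_iff.mp h

theorem RingTheory.Sequence.IsWeaklyRegular.map_C_append_monic {B : Type*} [CommRing B]
    {rs : List B} (hrs : IsWeaklyRegular B rs) {f : Polynomial B} (hf : f.Monic) :
    IsWeaklyRegular (Polynomial B) (rs.map Polynomial.C ++ [f]) := by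
  rw [isWeaklyRegular_append_iff]
  refine ⟨hrs.of_flat, ?_⟩
  rw [isWeaklyRegular_singleton_iff, isSMulRegular_iff_right_eq_zero_of_smul]
  intro x
  obtain ⟨g, rfl⟩ := Submodule.Quotient.mk_surjective _ x
  rw [← Submodule.Quotient.mk_smul, Submodule.Quotient.mk_eq_zero, Submodule.Quotient.mk_eq_zero,
    ← Ideal.map_ofList, smul_eq_mul, Ideal.mul_top]
  exact Polynomial.mem_map_C_of_monic_mul_mem _ hf

theorem MvPolynomial.finSuccEquiv_aeval_X_zero {R : Type*} [CommRing R] (n : ℕ)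
    (f : Polynomial R) : finSuccEquiv R n (Polynomial.aeval (X 0) f) = f.map C := by
  rw [← Polynomial.aeval_algHom_apply, finSuccEquiv_X_zero]
  induction f using Polynomial.induction_on' with
  | add p q hp hq => simp [hp, hq]
  | monomial n a => simp [← Polynomial.C_mul_X_pow_eq_monomial]

theorem MvPolynomial.finSuccEquiv_aeval_X_succ {R : Type*} [CommRing R] {n : ℕ} (i : Fin n)
    (f : Polynomial R) :
    finSuccEquiv R n (Polynomial.aeval (X i.succ) f) =
      Polynomial.C (Polynomial.aeval (X i) f) := by
  rw [← Polynomial.aeval_algHom_apply, finSuccEquiv_X_succ]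
  exact Polynomial.aeval_algebraMap_apply _ _ _

theorem MvPolynomial.exists_isWeaklyRegular_aeval_X {R : Type*} [CommRing R] (n : ℕ)
    (f : Fin n → Polynomial R) (hf : ∀ i, (f i).Monic) :
    ∃ rs : List (MvPolynomial (Fin n) R), rs.length = n ∧
      (∀ r ∈ rs, ∃ i, r = Polynomial.aeval (X i) (f i)) ∧
      IsWeaklyRegular (MvPolynomial (Fin n) R) rs := by
  induction n with
  | zero => exact ⟨[], by simp⟩
  | succ n ih =>
    obtain ⟨rs, hlen, hmem, hreg⟩ := ih (fun i => f i.succ) (fun i => hf _)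
    let e := (finSuccEquiv R n).symm
    refine ⟨(rs.map Polynomial.C ++ [(f 0).map C]).map e, by simp [hlen], ?_, ?_⟩
    · have h0 : e ((f 0).map C) = Polynomial.aeval (X 0) (f 0) := by
        rw [AlgEquiv.symm_apply_eq, finSuccEquiv_aeval_X_zero]
      have h1 (i : Fin n) : e (Polynomial.C (Polynomial.aeval (X i) (f i.succ))) =
          Polynomial.aeval (X i.succ) (f i.succ) := by
        rw [AlgEquiv.symm_apply_eq, finSuccEquiv_aeval_X_succ]
      intro r hr
      simp only [List.map_append, List.map_map, List.mem_append, List.mem_map, Function.comp,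
        List.map_cons, List.map_nil, List.mem_singleton] at hr
      rcases hr with ⟨s, hs, rfl⟩ | rfl
      · obtain ⟨i, rfl⟩ := hmem s hs
        exact ⟨i.succ, h1 i⟩
      · exact ⟨0, h0⟩
    · refine (e.toAddEquiv.isWeaklyRegular_congr ?_).mp
        (hreg.map_C_append_monic ((hf 0).map C))
      exact List.forall₂_map_right_iff.mpr (List.forall₂_same.mpr fun r _ x => map_mul e r x)

theorem MvPolynomial.exists_isWeaklyRegular_mem_of_finite_quotient {K : Type*} [Field K] {n : ℕ}
    (I : Ideal (MvPolynomial (Fin n) K)) [FiniteDimensional K (MvPolynomial (Fin n) K ⧸ I)] :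
    ∃ rs : List (MvPolynomial (Fin n) K), rs.length = n ∧ (∀ r ∈ rs, r ∈ I) ∧
      IsWeaklyRegular (MvPolynomial (Fin n) K) rs := by
  have hint (i : Fin n) : IsIntegral K (Ideal.Quotient.mk I (X i)) := Algebra.IsIntegral.isIntegral _
  obtain ⟨rs, hlen, hmem, hreg⟩ :=
    exists_isWeaklyRegular_aeval_X n _ (fun i => minpoly.monic (hint i))
  refine ⟨rs, hlen, fun r hr => ?_, hreg⟩
  obtain ⟨i, rfl⟩ := hmem r hr
  rw [← Ideal.Quotient.eq_zero_iff_mem, ← Ideal.Quotient.mkₐ_eq_mk K,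
    ← Polynomial.aeval_algHom_apply, Ideal.Quotient.mkₐ_eq_mk, minpoly.aeval]

end RegularSequences

theorem MvPolynomial.derivation_eq_sum_pderiv {σ R M : Type*} [Fintype σ] [CommSemiring R]
    [AddCommMonoid M] [Module R M] [Module (MvPolynomial σ R) M]
    [IsScalarTower R (MvPolynomial σ R) M]
    (D : Derivation R (MvPolynomial σ R) M) (F : MvPolynomial σ R) :
    D F = ∑ i, pderiv i F • D (X i) := by
  classical
  have hsum (E : σ → Derivation R (MvPolynomial σ R) M) (G : MvPolynomial σ R) :
      (∑ i, E i) G = ∑ i, E i G := by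
    have h1 := congr_fun (map_sum (Derivation.coeFnAddMonoidHom (R := R)
      (A := MvPolynomial σ R) (M := M)) E Finset.univ) G
    rwa [Finset.sum_apply] at h1
  have h : D = ∑ i, (LinearMap.toSpanSingleton (MvPolynomial σ R) M (D (X i))).compDer
      (pderiv i) := by
    refine derivation_ext fun j => ?_
    rw [hsum]
    simp [pderiv_X, Pi.single_apply]
  conv_lhs => rw [h, hsum]
  simp

namespace IsPoissonBracket

variable {R : Type*} [CommRing R] [Algebra ℂ R] {br : R → R → R} (hbr : IsPoissonBracket br)
include hbr

theorem zero_left (g : R) : br 0 g = 0 := by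
  simpa using hbr.1 1 0 0 g

theorem apply_eq_sum {n : ℕ} (φ : MvPolynomial (Fin n) ℂ →ₐ[ℂ] R) (F : MvPolynomial (Fin n) ℂ)
    (g : R) : br (φ F) g = ∑ i, φ (pderiv i F) * br (φ (X i)) g := by
  let _ := φ.toRingHom.toAlgebra
  have : IsScalarTower ℂ (MvPolynomial (Fin n) ℂ) R := .of_algHom φ
  let L : MvPolynomial (Fin n) ℂ →ₗ[ℂ] R :=
    { toFun := fun F => br (φ F) g
      map_add' := fun F G => by simpa using hbr.1 1 (φ F) (φ G) g
      map_smul' := fun c F => by simpa [hbr.zero_left] using hbr.1 c (φ F) 0 g }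
  let D : Derivation ℂ (MvPolynomial (Fin n) ℂ) R := Derivation.mk' L fun F G => by
    change br (φ (F * G)) g = φ F * br (φ G) g + φ G * br (φ F) g
    rw [map_mul, hbr.2.2.2.2.1]
    ring
  exact derivation_eq_sum_pderiv D F

theorem apply_eq_sum_sum {n : ℕ} (φ : MvPolynomial (Fin n) ℂ →ₐ[ℂ] R)
    (F G : MvPolynomial (Fin n) ℂ) :
    br (φ F) (φ G) =
      ∑ i, ∑ j, φ (pderiv i F) * φ (pderiv j G) * br (φ (X i)) (φ (X j)) := by
  rw [hbr.apply_eq_sum φ F]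
  refine Finset.sum_congr rfl fun i _ => ?_
  rw [hbr.2.2.1, hbr.apply_eq_sum φ G, ← Finset.sum_neg_distrib, Finset.mul_sum]
  refine Finset.sum_congr rfl fun j _ => ?_
  rw [hbr.2.2.1 (φ (X j))]
  ring
end IsPoissonBracket

theorem IsPoissonBracket.exists_alternatingMap {n : ℕ} (hn : n ≠ 0) (h : MvPolynomial (Fin n) ℂ)
    (hsing : FiniteDimensional ℂ
      (MvPolynomial (Fin n) ℂ ⧸ Ideal.span (insert h (Set.range fun i => pderiv i h))))
    {br : (MvPolynomial (Fin n) ℂ ⧸ Ideal.span {h}) → (MvPolynomial (Fin n) ℂ ⧸ Ideal.span {h}) →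
      (MvPolynomial (Fin n) ℂ ⧸ Ideal.span {h})} (hbr : IsPoissonBracket br) :
    ∃ e : (Fin n → MvPolynomial (Fin n) ℂ) [⋀^Fin 3]→ₗ[MvPolynomial (Fin n) ℂ]
        MvPolynomial (Fin n) ℂ, ∀ F G : MvPolynomial (Fin n) ℂ,
      br (Ideal.Quotient.mk (Ideal.span {h}) F) (Ideal.Quotient.mk (Ideal.span {h}) G) =
        Ideal.Quotient.mk (Ideal.span {h})
          (e ![fun i => pderiv i F, fun i => pderiv i G, fun i => pderiv i h]) := by
  obtain ⟨rs, hlen, hmem, hreg⟩ := exists_isWeaklyRegular_mem_of_finite_quotient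
    (Ideal.span (insert h (Set.range fun i => pderiv i h)))
  have hh : h ≠ 0 := by
    rintro rfl
    match rs, hlen with
    | [], hlen => exact hn hlen.symm
    | r :: rs, _ =>
      have hr : r = 0 := by
        have : Ideal.span (insert 0 (Set.range fun i : Fin n => pderiv i
            (0 : MvPolynomial (Fin n) ℂ))) = ⊥ := by
          rw [Ideal.span_eq_bot]
          rintro x (rfl | ⟨i, rfl⟩) <;> simp
        have hr := hmem r (by simp)
        rwa [this] at hr
      have hs := ((RingTheory.Sequence.isWeaklyRegular_cons_iff _ r rs).mp hreg).1
      rw [hr] at hs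
      exact one_ne_zero (hs (by simp : (0 : MvPolynomial (Fin n) ℂ) • (1 : MvPolynomial (Fin n) ℂ)
        = (0 : MvPolynomial (Fin n) ℂ) • 0))
  have : Invertible (2 : MvPolynomial (Fin n) ℂ) :=
    (Invertible.map (C : ℂ →+* MvPolynomial (Fin n) ℂ) 2).copy 2 (map_ofNat _ 2).symm
  set π := Ideal.Quotient.mkₐ ℂ (Ideal.span {h})
  obtain ⟨B, hB⟩ := AlternatingMap.exists_map_apply_eq_sum
    (φ := Ideal.Quotient.mk (Ideal.span {h})) Ideal.Quotient.mk_surjective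
    (fun i j => br (π (X i)) (π (X j))) (fun i j => hbr.2.2.1 _ _)
  have hπh : π h = 0 := Ideal.Quotient.eq_zero_iff_mem.mpr (Ideal.mem_span_singleton_self h)
  obtain ⟨e, he⟩ := AlternatingMap.exists_dvd_sub_of_dvd hh (fun i => pderiv i h) rs hlen hmem
    hreg B (fun v => by
      rw [← Ideal.mem_span_singleton, ← Ideal.Quotient.eq_zero_iff_mem, hB, Finset.sum_comm]
      refine Finset.sum_eq_zero fun j _ => ?_
      have h1 := hbr.apply_eq_sum π h (π (X j))
      rw [hπh, hbr.zero_left] at h1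
      have h2 := congr_arg (Ideal.Quotient.mk (Ideal.span {h}) (v j) * ·) h1.symm
      simp only [Finset.mul_sum, mul_zero] at h2
      rw [← h2]
      exact Finset.sum_congr rfl fun i _ => by
        rw [← mul_assoc, mul_comm (Ideal.Quotient.mk _ (v j))]
        rfl)
  refine ⟨e, fun F G => ?_⟩
  rw [← (Ideal.Quotient.mk_eq_mk_iff_sub_mem _ _).mpr (Ideal.mem_span_singleton.mpr (he _ _)), hB]
  exact hbr.apply_eq_sum_sum π F G

theorem AlternatingMap.apply_vecCons_eq_sum {R : Type*} [CommRing R] {ι : Type*} [Fintype ι]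
    [DecidableEq ι] {q : ℕ} (f : (ι → R) [⋀^Fin (q + 1)]→ₗ[R] R) (x : ι → R) (y : Fin q → ι → R) :
    f (Matrix.vecCons x y) = ∑ i, x i * f (Matrix.vecCons (Pi.single i 1) y) := by
  let l : (ι → R) →ₗ[R] R :=
    { toFun := fun x => f.curryLeft x y
      map_add' := fun a b => by rw [map_add, add_apply]
      map_smul' := fun r a => by rw [map_smul, smul_apply, RingHom.id_apply] }
  change l x = ∑ i, x i * l (Pi.single i 1)
  conv_lhs => rw [pi_eq_sum_univ' x]
  simp

theorem AlternatingMap.apply_eq_sum_pi_single {R : Type*} [CommRing R] {ι : Type*} [Fintype ι]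
    [DecidableEq ι] (e : (ι → R) [⋀^Fin 3]→ₗ[R] R) (u v w : ι → R) :
    e ![u, v, w] = ∑ i, ∑ j, ∑ k,
      e ![Pi.single i 1, Pi.single j 1, Pi.single k 1] * (u i * v j * w k) := by
  rw [apply_vecCons_eq_sum]
  refine Finset.sum_congr rfl fun i _ => ?_
  rw [← curryLeft_apply_apply, apply_vecCons_eq_sum, Finset.mul_sum]
  refine Finset.sum_congr rfl fun j _ => ?_
  rw [← curryLeft_apply_apply, apply_vecCons_eq_sum, Finset.mul_sum, Finset.mul_sum]
  refine Finset.sum_congr rfl fun k _ => ?_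
  simp only [curryLeft_apply_apply]
  ring

theorem poisson_bracket_reduced_form_hypersurface
    (n : ℕ) (hn : 3 ≤ n) (h : MvPolynomial (Fin n) ℂ)
    -- the hypersurface `h = 0` has isolated singularities
    (hsing : FiniteDimensional ℂ
      ((MvPolynomial (Fin n) ℂ) ⧸
        Ideal.span (insert h (Set.range fun i => pderiv i h))))
    (br : (MvPolynomial (Fin n) ℂ ⧸ Ideal.span {h}) →
      (MvPolynomial (Fin n) ℂ ⧸ Ideal.span {h}) →
      (MvPolynomial (Fin n) ℂ ⧸ Ideal.span {h}))
    (hbr : IsPoissonBracket br)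
    (P : Ideal (MvPolynomial (Fin n) ℂ ⧸ Ideal.span {h})) (hP : P.IsPrime) :
    ∃ p : Fin n → Fin n → Fin n →
        Localization.AtPrime (P.comap (Ideal.Quotient.mk (Ideal.span {h}))),
      -- `p` is alternating under permutations of its three indices
      (∀ (σ : Equiv.Perm (Fin 3)) (v : Fin 3 → Fin n),
        p (v (σ 0)) (v (σ 1)) (v (σ 2)) =
          (Equiv.Perm.sign σ : ℤ) • p (v 0) (v 1) (v 2)) ∧
      -- reduced form of the Poisson bracket after localization at `P`
      (∀ F G : MvPolynomial (Fin n) ℂ,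
        algebraMap _ (Localization.AtPrime P)
            (br (Ideal.Quotient.mk (Ideal.span {h}) F) (Ideal.Quotient.mk (Ideal.span {h}) G)) =
          ∑ i : Fin n, ∑ j : Fin n, ∑ k : Fin n,
            Localization.localRingHom (P.comap (Ideal.Quotient.mk (Ideal.span {h}))) P
                (Ideal.Quotient.mk (Ideal.span {h})) rfl (p i j k) *
              algebraMap _ (Localization.AtPrime P)
                (Ideal.Quotient.mk (Ideal.span {h})
                  (pderiv i F * pderiv j G * pderiv k h))) := by
  classical
  obtain ⟨e, he⟩ := hbr.exists_alternatingMap (by omega) h hsing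
  have hsingle (v : Fin 3 → Fin n) : ![Pi.single (v 0) 1, Pi.single (v 1) 1, Pi.single (v 2) 1] =
      fun t => (Pi.single (v t) 1 : Fin n → MvPolynomial (Fin n) ℂ) := by
    ext t : 1
    fin_cases t <;> rfl
  refine ⟨fun i j k => algebraMap _ _ (e ![Pi.single i 1, Pi.single j 1, Pi.single k 1]),
    fun σ v => ?_, fun F G => ?_⟩
  · have h1 := e.map_perm (fun t => Pi.single (v t) 1) σ
    beta_reduce
    rw [hsingle v, hsingle fun t => v (σ t), ← map_zsmul]
    exact congr_arg _ h1
  · rw [he, e.apply_eq_sum_pi_single]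
    simp only [map_sum, Localization.localRingHom_to_map, map_mul]
end

section
/- Suppose 2 ≤ n − m and the complete intersection h₁ = ⋯ = hₘ = 0 has isolated singularities. Let {-,-} be a Poisson bracket on O = A/(h₁,…,hₘ). Then for every prime ideal P of O there exists a family p : (Fin n)^(m+2) → A_{P'}, alternating under permutations of all of its m+2 indices (permuting the indices multiplies the value by the sign of the permutation), such that for all F, G ∈ A one has loc({[F],[G]}) = Σ_{i,j,k₁,…,kₘ} p(i,j,k₁,…,kₘ) • loc([∂ᵢF · ∂ⱼG · ∂_{k₁}h₁ ⋯ ∂_{kₘ}hₘ]) in O_P, where • denotes the A_{P'}-module action on O_P. -/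
open MvPolynomial

set_option synthInstance.maxHeartbeats 1000000
set_option maxHeartbeats 1000000

namespace ReducedForm

/-- The sign picked up by moving the basis vector `i` past the smaller elements of `S`. -/
def koszulSign (R : Type*) [CommRing R] {n : ℕ} (i : Fin n) (S : Finset (Fin n)) : R :=
  (-1) ^ (S.filter (· < i)).card

section Operators

variable {n : ℕ} {R : Type*} [CommRing R]

lemma koszulSign_mul_self (i : Fin n) (S : Finset (Fin n)) :
    koszulSign R i S * koszulSign R i S = 1 := by
  rw [koszulSign, ← pow_add, ← two_mul, pow_mul]
  simp

lemma koszulSign_insert_of_lt {i j : Fin n} {S : Finset (Fin n)} (hij : i < j) (hi : i ∉ S) :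
    koszulSign R j (insert i S) = -koszulSign R j S := by
  rw [koszulSign, koszulSign, Finset.filter_insert, if_pos hij,
    Finset.card_insert_of_notMem (by simp [hi]), pow_succ, mul_neg_one]

lemma koszulSign_insert_of_not_lt {i j : Fin n} {S : Finset (Fin n)} (hij : ¬ i < j) :
    koszulSign R j (insert i S) = koszulSign R j S := by
  rw [koszulSign, koszulSign, Finset.filter_insert, if_neg hij]

lemma koszulSign_erase_of_lt {i j : Fin n} {S : Finset (Fin n)} (hij : i < j) (hi : i ∈ S) :
    koszulSign R j (S.erase i) = -koszulSign R j S := by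
  conv_rhs => rw [← Finset.insert_erase hi]
  rw [koszulSign_insert_of_lt hij (Finset.notMem_erase i S), neg_neg]

lemma koszulSign_erase_of_not_lt {i j : Fin n} {S : Finset (Fin n)} (hij : ¬ i < j) :
    koszulSign R j (S.erase i) = koszulSign R j S := by
  by_cases hi : i ∈ S
  · conv_rhs => rw [← Finset.insert_erase hi]
    rw [koszulSign_insert_of_not_lt hij]
  · rw [Finset.erase_eq_of_notMem hi]

/-- Contraction with the `i`-th dual basis vector on the exterior algebra of `Rⁿ`, whose elements
are written in coordinates as functions on subsets of `Fin n`. -/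
def basisContract (i : Fin n) : (Finset (Fin n) → R) →ₗ[R] (Finset (Fin n) → R) where
  toFun x S := if i ∈ S then 0 else koszulSign R i S * x (insert i S)
  map_add' x y := by ext S; simp only [Pi.add_apply]; split_ifs <;> ring
  map_smul' c x := by
    ext S; simp only [Pi.smul_apply, smul_eq_mul, RingHom.id_apply]; split_ifs <;> ring

/-- Exterior multiplication by the `i`-th basis vector. -/
def basisWedge (i : Fin n) : (Finset (Fin n) → R) →ₗ[R] (Finset (Fin n) → R) where
  toFun x S := if i ∈ S then koszulSign R i S * x (S.erase i) else 0
  map_add' x y := by ext S; simp only [Pi.add_apply]; split_ifs <;> ring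
  map_smul' c x := by
    ext S; simp only [Pi.smul_apply, smul_eq_mul, RingHom.id_apply]; split_ifs <;> ring

lemma basisContract_apply (i : Fin n) (x : Finset (Fin n) → R) (S : Finset (Fin n)) :
    basisContract i x S = if i ∈ S then 0 else koszulSign R i S * x (insert i S) := rfl

lemma basisWedge_apply (i : Fin n) (x : Finset (Fin n) → R) (S : Finset (Fin n)) :
    basisWedge i x S = if i ∈ S then koszulSign R i S * x (S.erase i) else 0 := rfl

lemma basisContract_self (i : Fin n) (x : Finset (Fin n) → R) :
    basisContract i (basisContract i x) = 0 := by
  ext S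
  simp [basisContract_apply]

lemma basisContract_comm (i j : Fin n) (x : Finset (Fin n) → R) :
    basisContract i (basisContract j x) = -basisContract j (basisContract i x) := by
  have key : ∀ i j : Fin n, i < j →
      basisContract i (basisContract j x) = -basisContract j (basisContract i x) := by
    intro i j hij
    ext S
    simp only [basisContract_apply, Pi.neg_apply, Finset.mem_insert, hij.ne, hij.ne', false_or]
    by_cases hi : i ∈ S <;> by_cases hj : j ∈ S <;> simp only [hi, hj, if_true, if_false, mul_zero,
      neg_zero]
    rw [koszulSign_insert_of_lt hij hi, koszulSign_insert_of_not_lt hij.not_gt,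
      Finset.insert_comm]
    ring
  rcases lt_trichotomy i j with hij | rfl | hij
  · exact key i j hij
  · simp [basisContract_self]
  · rw [key j i hij, neg_neg]

lemma basisContract_basisWedge (i j : Fin n) (x : Finset (Fin n) → R) :
    basisContract i (basisWedge j x) =
      (if i = j then (1 : R) else 0) • x - basisWedge j (basisContract i x) := by
  ext S
  by_cases hij : i = j
  · subst hij
    simp only [basisContract_apply, basisWedge_apply, Pi.sub_apply, Pi.smul_apply, if_true,
      smul_eq_mul, one_mul, Finset.mem_insert, true_or, Finset.mem_erase, ne_eq, not_true_eq_false,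
      false_and, if_false]
    by_cases hi : i ∈ S
    · simp only [hi, if_true, Finset.insert_erase hi,
        koszulSign_erase_of_not_lt (lt_irrefl i)]
      rw [← mul_assoc, koszulSign_mul_self]
      ring
    · simp only [hi, if_false, Finset.erase_insert hi,
        koszulSign_insert_of_not_lt (lt_irrefl i)]
      rw [← mul_assoc, koszulSign_mul_self]
      ring
  · have hji : j ≠ i := fun h => hij h.symm
    simp only [basisContract_apply, basisWedge_apply, Pi.sub_apply, Pi.smul_apply, smul_eq_mul,
      Finset.mem_insert, Finset.mem_erase, hji, hij, false_or, ne_eq,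
      not_false_eq_true, true_and]
    by_cases hi : i ∈ S <;> by_cases hj : j ∈ S <;> simp only [hi, hj, if_true, if_false, mul_zero,
      zero_mul, sub_zero]
    rw [Finset.erase_insert_of_ne hij]
    rcases lt_or_gt_of_ne hij with h | h
    · rw [koszulSign_insert_of_lt h hi, koszulSign_erase_of_not_lt h.not_gt]
      ring
    · rw [koszulSign_insert_of_not_lt h.not_gt, koszulSign_erase_of_lt h hj]
      ring

/-- Contraction with the covector `g`. -/
def contract (g : Fin n → R) : (Finset (Fin n) → R) →ₗ[R] (Finset (Fin n) → R) :=
  ∑ i, g i • basisContract i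

/-- Exterior multiplication by the vector `u`. -/
def wedge (u : Fin n → R) : (Finset (Fin n) → R) →ₗ[R] (Finset (Fin n) → R) :=
  ∑ i, u i • basisWedge i

lemma contract_apply (g : Fin n → R) (x : Finset (Fin n) → R) :
    contract g x = ∑ i, g i • basisContract i x := by
  simp [contract, LinearMap.sum_apply]

lemma wedge_apply (u : Fin n → R) (x : Finset (Fin n) → R) :
    wedge u x = ∑ i, u i • basisWedge i x := by
  simp [wedge, LinearMap.sum_apply]

lemma contract_single (i : Fin n) (x : Finset (Fin n) → R) :
    contract (Pi.single i 1) x = basisContract i x := by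
  rw [contract_apply, Finset.sum_eq_single i]
  · simp
  · intro j _ hj
    simp [hj]
  · simp

lemma contract_comm (g g' : Fin n → R) (x : Finset (Fin n) → R) :
    contract g (contract g' x) = -contract g' (contract g x) := by
  simp only [contract_apply, map_sum, map_smul, Finset.smul_sum, ← Finset.sum_neg_distrib]
  rw [Finset.sum_comm]
  refine Finset.sum_congr rfl fun i _ => Finset.sum_congr rfl fun j _ => ?_
  rw [basisContract_comm, smul_neg, smul_neg, smul_comm]

lemma sum_sum_eq_zero_of_antisymm {ι V : Type*} [Fintype ι] [AddCommGroup V] (T : ι → ι → V)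
    (hT : ∀ i j, T i j = -T j i) (hT' : ∀ i, T i i = 0) : ∑ i, ∑ j, T i j = 0 := by
  classical
  rw [← Fintype.sum_prod_type' T]
  refine Finset.sum_involution (fun q _ => q.swap) ?_ ?_ ?_ ?_
  · rintro ⟨i, j⟩ _
    simp [hT i j]
  · rintro ⟨i, j⟩ _ hne heq
    simp only [Prod.swap_prod_mk, Prod.mk.injEq] at heq
    exact hne (by simpa [heq.1] using hT' i)
  · simp
  · simp

lemma contract_self (g : Fin n → R) (x : Finset (Fin n) → R) :
    contract g (contract g x) = 0 := by
  simp only [contract_apply, map_sum, map_smul, Finset.smul_sum]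
  refine sum_sum_eq_zero_of_antisymm _ (fun i j => ?_) fun i => ?_
  · rw [basisContract_comm, smul_neg, smul_neg, smul_comm]
  · rw [basisContract_self, smul_zero, smul_zero]

lemma contract_wedge (g u : Fin n → R) (x : Finset (Fin n) → R) :
    contract g (wedge u x) = (∑ i, g i * u i) • x - wedge u (contract g x) := by
  simp only [contract_apply, wedge_apply, map_sum, map_smul, Finset.smul_sum,
    basisContract_basisWedge, smul_sub, Finset.sum_sub_distrib, Finset.sum_smul]
  congr 1
  · refine Finset.sum_congr rfl fun i _ => ?_
    rw [Finset.sum_eq_single i]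
    · simp only [if_true, one_smul, mul_smul]
      exact smul_comm _ _ _
    · intro j _ hj
      simp [hj]
    · simp
  · rw [Finset.sum_comm]
    refine Finset.sum_congr rfl fun i _ => Finset.sum_congr rfl fun j _ => ?_
    rw [smul_comm]

lemma contract_eq_zero_of_card {g : Fin n → R} {x : Finset (Fin n) → R} {r : ℕ}
    (hx : ∀ S, x S ≠ 0 → S.card = r + 1) (S : Finset (Fin n)) (hS : contract g x S ≠ 0) :
    S.card = r := by
  rw [contract_apply, Finset.sum_apply] at hS
  obtain ⟨i, -, hi⟩ := Finset.exists_ne_zero_of_sum_ne_zero hS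
  rw [Pi.smul_apply, basisContract_apply] at hi
  by_cases hiS : i ∈ S
  · simp [hiS] at hi
  · rw [if_neg hiS] at hi
    have := hx (insert i S) fun h0 => hi (by simp [h0])
    rw [Finset.card_insert_of_notMem hiS] at this
    omega

lemma wedge_eq_zero_of_card {u : Fin n → R} {x : Finset (Fin n) → R} {r : ℕ}
    (hx : ∀ S, x S ≠ 0 → S.card = r) (S : Finset (Fin n)) (hS : wedge u x S ≠ 0) :
    S.card = r + 1 := by
  rw [wedge_apply, Finset.sum_apply] at hS
  obtain ⟨i, -, hi⟩ := Finset.exists_ne_zero_of_sum_ne_zero hS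
  rw [Pi.smul_apply, basisWedge_apply] at hi
  by_cases hiS : i ∈ S
  · rw [if_pos hiS] at hi
    rw [← hx (S.erase i) fun h0 => hi (by simp [h0]), Finset.card_erase_add_one hiS]
  · simp [hiS] at hi

lemma contract_map {R' : Type*} [CommRing R'] (φ : R →+* R') (g : Fin n → R)
    (x : Finset (Fin n) → R) (S : Finset (Fin n)) :
    contract (fun i => φ (g i)) (fun T => φ (x T)) S = φ (contract g x S) := by
  simp only [contract_apply, Finset.sum_apply, map_sum, Pi.smul_apply, smul_eq_mul, map_mul,
    basisContract_apply]
  refine Finset.sum_congr rfl fun i _ => ?_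
  split_ifs <;> simp [koszulSign]

/-- Successive contraction with a list of covectors, the head of the list first. -/
def contractList (l : List (Fin n → R)) (x : Finset (Fin n) → R) : Finset (Fin n) → R :=
  l.foldl (fun y g => contract g y) x

@[simp] lemma contractList_nil (x : Finset (Fin n) → R) : contractList [] x = x := rfl

@[simp] lemma contractList_cons (g : Fin n → R) (l : List (Fin n → R)) (x : Finset (Fin n) → R) :
    contractList (g :: l) x = contractList l (contract g x) := rfl

lemma contractList_add (l : List (Fin n → R)) (x y : Finset (Fin n) → R) :
    contractList l (x + y) = contractList l x + contractList l y := by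
  induction l generalizing x y with
  | nil => rfl
  | cons g l ih => simp [ih]

lemma contractList_smul (l : List (Fin n → R)) (c : R) (x : Finset (Fin n) → R) :
    contractList l (c • x) = c • contractList l x := by
  induction l generalizing x with
  | nil => rfl
  | cons g l ih => simp [ih]

lemma contractList_zero (l : List (Fin n → R)) :
    contractList l (0 : Finset (Fin n) → R) = 0 := by
  simpa using contractList_smul l 0 0

lemma contractList_neg (l : List (Fin n → R)) (x : Finset (Fin n) → R) :
    contractList l (-x) = -contractList l x := by
  simpa using contractList_smul l (-1) x

lemma contractList_sum {ι : Type*} (s : Finset ι) (l : List (Fin n → R))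
    (x : ι → Finset (Fin n) → R) :
    contractList l (∑ i ∈ s, x i) = ∑ i ∈ s, contractList l (x i) := by
  classical
  induction s using Finset.induction_on with
  | empty => simp [contractList_zero]
  | insert i s hi ih => rw [Finset.sum_insert hi, Finset.sum_insert hi, contractList_add, ih]

lemma contractList_contract_of_mem {l : List (Fin n → R)} {g : Fin n → R} (hg : g ∈ l)
    (x : Finset (Fin n) → R) : contractList l (contract g x) = 0 := by
  induction l generalizing x with
  | nil => simp at hg
  | cons g' l ih =>
    rw [contractList_cons]
    rcases List.mem_cons.mp hg with rfl | hg
    · rw [contract_self, contractList_zero]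
    · rw [contract_comm, contractList_neg, ih hg, neg_zero]

lemma contractList_contract_contract (l : List (Fin n → R)) (g g' : Fin n → R)
    (x : Finset (Fin n) → R) :
    contractList l (contract g (contract g' x)) = contract g (contract g' (contractList l x)) := by
  induction l generalizing x with
  | nil => rfl
  | cons g'' l ih =>
    rw [contractList_cons, contractList_cons, contract_comm g'' g, contract_comm g'' g', map_neg,
      neg_neg, ih]

lemma contractList_eq_zero_of_card {l : List (Fin n → R)} {x : Finset (Fin n) → R} {r : ℕ}
    (hx : ∀ S, x S ≠ 0 → S.card = r + l.length) (S : Finset (Fin n))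
    (hS : contractList l x S ≠ 0) : S.card = r := by
  induction l generalizing x with
  | nil => exact hx S hS
  | cons g l ih => exact ih (contract_eq_zero_of_card hx) hS

lemma contractList_map {R' : Type*} [CommRing R'] (φ : R →+* R') (l : List (Fin n → R))
    (x : Finset (Fin n) → R) (S : Finset (Fin n)) :
    contractList (l.map fun g i => φ (g i)) (fun T => φ (x T)) S = φ (contractList l x S) := by
  induction l generalizing x with
  | nil => rfl
  | cons g l ih =>
    rw [List.map_cons, contractList_cons, contractList_cons, ← ih]
    congr 1
    ext T
    exact contract_map φ g x T

lemma contractList_ofFn_eq_sum {r : ℕ} (g : Fin r → Fin n → R) (x : Finset (Fin n) → R) :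
    contractList (List.ofFn g) x = ∑ v : Fin r → Fin n,
      (∏ t, g t (v t)) • contractList (List.ofFn fun t => Pi.single (v t) 1) x := by
  induction r generalizing x with
  | zero => simp
  | succ r ih =>
    rw [← (Fin.consEquiv fun _ => Fin n).sum_comp, Fintype.sum_prod_type]
    simp only [Fin.consEquiv_apply, List.ofFn_succ, contractList_cons, Fin.prod_univ_succ,
      Fin.cons_zero, Fin.cons_succ, contract_single]
    rw [contract_apply, contractList_sum]
    refine Finset.sum_congr rfl fun i _ => ?_
    rw [contractList_smul, ih, Finset.smul_sum]
    simp only [mul_smul]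

lemma contractList_ofFn_comp_swap {r : ℕ} (g : Fin (r + 1) → Fin n → R) (i : Fin r)
    (x : Finset (Fin n) → R) :
    contractList (List.ofFn (g ∘ Equiv.swap i.castSucc i.succ)) x =
      -contractList (List.ofFn g) x := by
  induction r generalizing x with
  | zero => exact i.elim0
  | succ r ih =>
    cases i using Fin.cases with
    | zero =>
      have h2 : ∀ t : Fin r, Equiv.swap (0 : Fin (r + 2)) 1 t.succ.succ = t.succ.succ := fun t =>
        Equiv.swap_apply_of_ne_of_ne (by simp [Fin.ext_iff]) (by simp [Fin.ext_iff])
      simp only [List.ofFn_succ, contractList_cons, Function.comp_apply, Fin.castSucc_zero,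
        Fin.succ_zero_eq_one, Equiv.swap_apply_left, Equiv.swap_apply_right, h2]
      rw [contract_comm, contractList_neg]
    | succ j =>
      have h0 : Equiv.swap j.succ.castSucc j.succ.succ (0 : Fin (r + 2)) = 0 :=
        Equiv.swap_apply_of_ne_of_ne (by simp [Fin.ext_iff]) (by simp [Fin.ext_iff])
      have hs : ∀ t : Fin (r + 1), Equiv.swap j.succ.castSucc j.succ.succ t.succ =
          (Equiv.swap j.castSucc j.succ t).succ := fun t => by
        rw [← Fin.succ_castSucc]
        exact ((Fin.succ_injective _).swap_apply _ _ _)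
      rw [List.ofFn_succ, List.ofFn_succ (f := g), contractList_cons, contractList_cons]
      simp only [Function.comp_apply, h0, hs]
      exact ih (fun t => g t.succ) j _

lemma contractList_ofFn_comp_perm {r : ℕ} (σ : Equiv.Perm (Fin r)) (g : Fin r → Fin n → R)
    (x : Finset (Fin n) → R) :
    contractList (List.ofFn (g ∘ σ)) x = (Equiv.Perm.sign σ : ℤ) • contractList (List.ofFn g) x := by
  cases r with
  | zero =>
    rw [Subsingleton.elim σ 1]
    simp
  | succ r =>
    have hσ : σ ∈ Submonoid.closure
        (Set.range fun i : Fin r => Equiv.swap i.castSucc i.succ) := by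
      rw [Equiv.Perm.mclosure_swap_castSucc_succ]
      trivial
    induction hσ using Submonoid.closure_induction generalizing g with
    | mem τ hτ =>
      obtain ⟨i, rfl⟩ := hτ
      simp only [contractList_ofFn_comp_swap]
      rw [Equiv.Perm.sign_swap (by simp [Fin.ext_iff])]
      simp
    | one => simp
    | mul τ τ' _ _ h1 h2 =>
      rw [Equiv.Perm.coe_mul, ← Function.comp_assoc, h2, h1, Equiv.Perm.sign_mul, Units.val_mul,
        mul_comm, mul_smul]

end Operators

section Complex

variable {m n : ℕ} {R : Type*} [CommRing R]

/-- Ambient module of the chains: families, indexed by monomials in `m` variables, of elements of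
the exterior algebra of `Rⁿ`. -/
abbrev Chain (m n : ℕ) (R : Type*) : Type _ := (Fin m → ℕ) → Finset (Fin n) → R

/-- `IsGraded i z` says that `z` is a chain of degree `i`: a bivector for `i = 0`, and a family of
`(m + 2 + j)`-vectors indexed by the monomials of degree `j` for `i = j + 1`. -/
def IsGraded (i : ℕ) (z : Chain m n R) : Prop :=
  match i with
  | 0 => ∀ a S, z a S ≠ 0 → a = 0 ∧ S.card = 2
  | j + 1 => ∀ a S, z a S ≠ 0 → ∑ k, a k = j ∧ S.card = m + 2 + j

/-- The Koszul type differential `z ↦ ∑ₖ tₖ ⌟ gₖ z`, where `tₖ` shifts the monomial. -/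
def shiftContract (g : Fin m → Fin n → R) : Chain m n R →ₗ[R] Chain m n R where
  toFun z a := ∑ k, contract (g k) (z (a + Pi.single k 1))
  map_add' x y := by ext a : 1; simp [Finset.sum_add_distrib]
  map_smul' c x := by ext a : 1; simp [Finset.smul_sum]

/-- The differential from degree `i + 1` to degree `i` of the generalized Koszul complex
`⋯ → Λᵐ⁺³ ⊗ D₁ → Λᵐ⁺² → Λ²` attached to the `m × n` matrix `g`. -/
def boundary (g : Fin m → Fin n → R) : ℕ → (Chain m n R →ₗ[R] Chain m n R)
  | 0 =>
    { toFun := fun z a => contractList (List.ofFn g) (z a)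
      map_add' := fun x y => by ext a : 1; exact contractList_add _ _ _
      map_smul' := fun c x => by ext a : 1; exact contractList_smul _ _ _ }
  | _ + 1 => shiftContract g

/-- Cycles of degree `i`; in degree `0` these are the bivectors killed by all rows of `g`. -/
def IsCycle (g : Fin m → Fin n → R) (i : ℕ) (z : Chain m n R) : Prop :=
  match i with
  | 0 => ∀ k a, contract (g k) (z a) = 0
  | j + 1 => boundary g j z = 0

/-- Exactness of the generalized Koszul complex in degree `i`. -/
def ExactAt (g : Fin m → Fin n → R) (i : ℕ) : Prop :=
  ∀ z, IsGraded i z → IsCycle g i z → ∃ y, IsGraded (i + 1) y ∧ boundary g i y = z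

/-- The ideal of maximal minors. -/
def minorIdeal (g : Fin m → Fin n → R) : Ideal R :=
  Ideal.span (Set.range fun c : Fin m → Fin n => (Matrix.of fun i j => g i (c j)).det)

lemma shiftContract_apply (g : Fin m → Fin n → R) (z : Chain m n R) (a : Fin m → ℕ) :
    shiftContract g z a = ∑ k, contract (g k) (z (a + Pi.single k 1)) := rfl

lemma boundary_zero_apply (g : Fin m → Fin n → R) (z : Chain m n R) (a : Fin m → ℕ) :
    boundary g 0 z a = contractList (List.ofFn g) (z a) := rfl

lemma shiftContract_shiftContract (g : Fin m → Fin n → R) (z : Chain m n R) :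
    shiftContract g (shiftContract g z) = 0 := by
  ext a : 1
  simp only [shiftContract_apply, map_sum]
  refine sum_sum_eq_zero_of_antisymm _ (fun i j => ?_) fun i => contract_self _ _
  rw [contract_comm, add_right_comm]

lemma boundary_boundary (g : Fin m → Fin n → R) (i : ℕ) (z : Chain m n R) :
    boundary g i (boundary g (i + 1) z) = 0 := by
  cases i with
  | zero =>
    ext a : 1
    rw [boundary_zero_apply, boundary, shiftContract_apply, contractList_sum]
    exact Finset.sum_eq_zero fun k _ =>
      contractList_contract_of_mem (List.mem_ofFn.mpr ⟨k, rfl⟩) _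
  | succ i => exact shiftContract_shiftContract g z

lemma IsGraded.add {i : ℕ} {x y : Chain m n R} (hx : IsGraded i x) (hy : IsGraded i y) :
    IsGraded i (x + y) := by
  have key : ∀ a S, (x + y) a S ≠ 0 → x a S ≠ 0 ∨ y a S ≠ 0 := fun a S h => by
    by_contra! h'
    exact h (by simp [h'.1, h'.2])
  cases i <;> exact fun a S h => (key a S h).elim (hx a S) (hy a S)

lemma IsGraded.of_eq_zero {i : ℕ} {x y : Chain m n R} (hx : IsGraded i x)
    (h : ∀ a S, x a S = 0 → y a S = 0) : IsGraded i y := by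
  cases i <;> exact fun a S h' => hx a S fun h0 => h' (h a S h0)

lemma IsGraded.smul {i : ℕ} {x : Chain m n R} (hx : IsGraded i x) (c : R) : IsGraded i (c • x) :=
  hx.of_eq_zero fun a S h => by simp [h]

lemma IsGraded.neg {i : ℕ} {x : Chain m n R} (hx : IsGraded i x) : IsGraded i (-x) :=
  hx.of_eq_zero fun a S h => by simp [h]

lemma IsGraded.boundary {i : ℕ} {z : Chain m n R} (hz : IsGraded (i + 1) z)
    (g : Fin m → Fin n → R) : IsGraded i (boundary g i z) := by
  cases i with
  | zero =>
    intro a S h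
    rw [boundary_zero_apply] at h
    refine ⟨?_, contractList_eq_zero_of_card (fun T hT => ?_) S h⟩
    · by_contra ha
      have : z a = 0 := by
        ext T
        by_contra hT
        have := (hz a T hT).1
        simp only [Finset.sum_eq_zero_iff, Finset.mem_univ, true_implies] at this
        exact ha (funext this)
      rw [this, contractList_zero] at h
      exact h rfl
    · have : T.card = m + 2 + 0 := (hz a T hT).2
      rw [List.length_ofFn]
      omega
  | succ i =>
    intro a S h
    change shiftContract g z a S ≠ 0 at h
    rw [shiftContract_apply, Finset.sum_apply] at h
    obtain ⟨k, -, hk⟩ := Finset.exists_ne_zero_of_sum_ne_zero h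
    have hk0 : z (a + Pi.single k 1) ≠ 0 := fun h0 => hk (by simp [h0])
    obtain ⟨T, hT⟩ := Function.ne_iff.mp hk0
    have h1 := (hz _ T hT).1
    simp only [Pi.add_apply, Finset.sum_add_distrib, Finset.sum_pi_single', Finset.mem_univ,
      if_true] at h1
    exact ⟨by omega, contract_eq_zero_of_card (fun T hT => (hz _ T hT).2) S hk⟩

lemma IsGraded.eq_zero_of_le {i : ℕ} {z : Chain m n R} (hz : IsGraded (i + 1) z)
    (h : n < m + 2 + i) : z = 0 := by
  ext a S
  by_contra h0
  have h1 := (hz a S h0).2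
  have h2 := S.card_le_univ
  rw [Fintype.card_fin] at h2
  omega

/-! ### Maximal minors annihilate the homology -/

/-- The part of the contracting homotopy attached to a vector `u` and the index `k`. -/
def homotopy (u : Fin n → R) (k : Fin m) (z : Chain m n R) : Chain m n R :=
  fun a => if a k = 0 then 0 else wedge u (z (a - Pi.single k 1))

/-- The obstruction for `homotopy` to be a contracting homotopy. -/
def remainder (g u : Fin n → R) (k : Fin m) (z : Chain m n R) : Chain m n R :=
  fun a => if a k = 0 then wedge u (contract g (z a)) else 0

lemma add_single_sub_single {k l : Fin m} {a : Fin m → ℕ} (ha : a k ≠ 0) :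
    a + Pi.single l 1 - Pi.single k 1 = a - Pi.single k 1 + Pi.single l 1 := by
  ext j
  rcases eq_or_ne j k with rfl | hjk
  · simp only [Pi.sub_apply, Pi.add_apply, Pi.single_eq_same]
    omega
  · simp [hjk]

lemma shiftContract_homotopy {g : Fin m → Fin n → R} {u : Fin n → R} {k : Fin m} {Δ : R}
    (hu : ∀ l, ∑ i, g l i * u i = if l = k then Δ else 0) (z : Chain m n R) :
    shiftContract g (homotopy u k z) =
      Δ • z - remainder (g k) u k z - homotopy u k (shiftContract g z) := by
  ext a : 1
  rw [shiftContract_apply, Pi.sub_apply, Pi.sub_apply, Pi.smul_apply, homotopy, remainder]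
  by_cases ha : a k = 0
  · rw [if_pos ha, if_pos ha, Finset.sum_eq_single k]
    · rw [homotopy, if_neg (by simp), contract_wedge, hu, if_pos rfl, sub_zero]
      simp
    · intro l _ hl
      rw [homotopy, if_pos (by simp [ha, hl.symm]), map_zero]
    · simp
  · rw [if_neg ha, if_neg ha, shiftContract_apply, map_sum, sub_zero, eq_sub_iff_add_eq,
      ← Finset.sum_add_distrib, Finset.sum_eq_single k]
    · rw [homotopy, if_neg (by simp), contract_wedge, hu, if_pos rfl,
        add_single_sub_single ha]
      have : a - Pi.single k 1 + Pi.single k 1 = a := by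
        ext j
        rcases eq_or_ne j k with rfl | hjk
        · simp only [Pi.sub_apply, Pi.add_apply, Pi.single_eq_same]
          omega
        · simp [hjk]
      rw [this, sub_add_cancel]
    · intro l _ hl
      rw [homotopy, if_neg (by simp [ha]), contract_wedge, hu, if_neg hl,
        add_single_sub_single ha, zero_smul, zero_sub, neg_add_cancel]
    · simp

lemma IsGraded.homotopy {i : ℕ} {z : Chain m n R} (hz : IsGraded (i + 1) z) (u : Fin n → R)
    (k : Fin m) : IsGraded (i + 2) (homotopy u k z) := by
  intro a S h
  rw [ReducedForm.homotopy] at h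
  by_cases ha : a k = 0
  · simp [ha] at h
  · rw [if_neg ha] at h
    have h0 : z (a - Pi.single k 1) ≠ 0 := fun h0 => h (by simp [h0])
    obtain ⟨T, hT⟩ := Function.ne_iff.mp h0
    have h1 := (hz _ T hT).1
    have h2 : ∑ j, a j = ∑ j, (a - Pi.single k 1 : Fin m → ℕ) j + 1 := by
      rw [← Finset.add_sum_erase _ _ (Finset.mem_univ k),
        ← Finset.add_sum_erase _ (a - Pi.single k 1 : Fin m → ℕ) (Finset.mem_univ k),
        Finset.sum_congr rfl (g := (a - Pi.single k 1 : Fin m → ℕ))]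
      · simp only [Pi.sub_apply, Pi.single_eq_same]
        omega
      · intro j hj
        simp [Finset.ne_of_mem_erase hj]
    exact ⟨by omega, wedge_eq_zero_of_card (fun T hT => (hz _ T hT).2) S h⟩

lemma IsGraded.remainder {i : ℕ} {z : Chain m n R} (hz : IsGraded (i + 1) z) (g u : Fin n → R)
    (k : Fin m) : IsGraded (i + 1) (remainder g u k z) := by
  intro a S h
  rw [ReducedForm.remainder] at h
  by_cases ha : a k = 0
  · rw [if_pos ha] at h
    have h0 : z a ≠ 0 := fun h0 => h (by simp [h0])
    obtain ⟨T, hT⟩ := Function.ne_iff.mp h0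
    refine ⟨(hz a T hT).1, ?_⟩
    exact wedge_eq_zero_of_card (r := m + 1 + i)
      (contract_eq_zero_of_card fun T hT => by rw [(hz a T hT).2]; omega) S h |>.trans (by omega)
  · simp [ha] at h

/-- Iterated remainder along a list of indices. -/
def remainderList (g u : Fin m → Fin n → R) (l : List (Fin m)) (z : Chain m n R) : Chain m n R :=
  l.foldr (fun k y => remainder (g k) (u k) k y) z

lemma exists_pow_smul_eq_remainderList {g u : Fin m → Fin n → R} {Δ : R}
    (hu : ∀ l k, ∑ i, g l i * u k i = if l = k then Δ else 0) {i : ℕ} {z : Chain m n R}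
    (hz : IsGraded (i + 1) z) (hz0 : shiftContract g z = 0) (l : List (Fin m)) :
    IsGraded (i + 1) (remainderList g u l z) ∧ shiftContract g (remainderList g u l z) = 0 ∧
      ∃ y, IsGraded (i + 2) y ∧ Δ ^ l.length • z = remainderList g u l z + shiftContract g y := by
  induction l with
  | nil =>
    refine ⟨hz, hz0, 0, fun a S h => absurd rfl h, ?_⟩
    simp [remainderList]
  | cons k l ih =>
    obtain ⟨h1, h2, y, hy, h3⟩ := ih
    set x := remainderList g u l z with hx
    have hk : remainderList g u (k :: l) z = remainder (g k) (u k) k x := rfl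
    have h4 := shiftContract_homotopy (fun l => hu l k) x
    have h0 : homotopy (u k) k (0 : Chain m n R) = 0 := by
      ext a : 1
      simp [homotopy]
    rw [h2, h0, sub_zero] at h4
    rw [hk]
    refine ⟨h1.remainder _ _ _, ?_, Δ • y + homotopy (u k) k x, (hy.smul Δ).add (h1.homotopy _ _),
      ?_⟩
    · have h5 := shiftContract_shiftContract g (homotopy (u k) k x)
      rw [h4, map_sub, map_smul, h2, smul_zero, zero_sub, neg_eq_zero] at h5
      exact h5
    · rw [List.length_cons, pow_succ', mul_smul, h3, map_add, map_smul, h4, smul_add]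
      abel

lemma remainderList_apply_of_ne_zero (g u : Fin m → Fin n → R) {l : List (Fin m)} {k : Fin m}
    (hk : k ∈ l) (z : Chain m n R) {a : Fin m → ℕ} (ha : a k ≠ 0) :
    remainderList g u l z a = 0 := by
  induction l with
  | nil => simp at hk
  | cons k' l ih =>
    change remainder (g k') (u k') k' (remainderList g u l z) a = 0
    rw [remainder]
    split_ifs with h
    · rcases List.mem_cons.mp hk with rfl | hk
      · exact absurd h ha
      · rw [ih hk, map_zero, map_zero]
    · rfl

lemma remainderList_apply_zero (g u : Fin m → Fin n → R) (l : List (Fin m)) (z : Chain m n R) :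
    remainderList g u l z 0 = l.foldr (fun k y => wedge (u k) (contract (g k) y)) (z 0) := by
  induction l with
  | nil => rfl
  | cons k l ih =>
    change remainder (g k) (u k) k (remainderList g u l z) 0 = _
    rw [remainder, if_pos (Pi.zero_apply k), ih, List.foldr_cons]

lemma contract_foldr_wedge_contract {g u : Fin m → Fin n → R} {Δ : R}
    (hu : ∀ l k, ∑ i, g l i * u k i = if l = k then Δ else 0) {k : Fin m} {l : List (Fin m)}
    (hk : k ∉ l) (x : Finset (Fin n) → R) :
    contract (g k) (l.foldr (fun k y => wedge (u k) (contract (g k) y)) x) =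
      l.foldr (fun k y => wedge (u k) (contract (g k) y)) (contract (g k) x) := by
  induction l with
  | nil => rfl
  | cons k' l ih =>
    rw [List.mem_cons, not_or] at hk
    rw [List.foldr_cons, List.foldr_cons, contract_wedge, hu, if_neg hk.1, zero_smul, zero_sub,
      contract_comm, map_neg, neg_neg, ih hk.2]

lemma foldr_wedge_contract_eq_zero {g u : Fin m → Fin n → R} {Δ : R}
    (hu : ∀ l k, ∑ i, g l i * u k i = if l = k then Δ else 0) {l : List (Fin m)}
    (hl : l.Nodup) {x : Finset (Fin n) → R} (hx : contractList (l.map g) x = 0) :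
    l.foldr (fun k y => wedge (u k) (contract (g k) y)) x = 0 := by
  induction l generalizing x with
  | nil => exact hx
  | cons k l ih =>
    rw [List.nodup_cons] at hl
    rw [List.foldr_cons, contract_foldr_wedge_contract hu hl.1, ih hl.2 hx, map_zero]

lemma contract_foldr_wedge {g u : Fin m → Fin n → R} {Δ : R}
    (hu : ∀ l k, ∑ i, g l i * u k i = if l = k then Δ else 0) {k : Fin m} {l : List (Fin m)}
    (hk : k ∉ l) {x : Finset (Fin n) → R} (hx : contract (g k) x = 0) :
    contract (g k) (l.foldr (fun k y => wedge (u k) y) x) = 0 := by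
  induction l with
  | nil => exact hx
  | cons k' l ih =>
    rw [List.mem_cons, not_or] at hk
    rw [List.foldr_cons, contract_wedge, hu, if_neg hk.1, zero_smul, zero_sub, ih hk.2, map_zero,
      neg_zero]

lemma contractList_foldr_wedge {g u : Fin m → Fin n → R} {Δ : R}
    (hu : ∀ l k, ∑ i, g l i * u k i = if l = k then Δ else 0) {l : List (Fin m)}
    (hl : l.Nodup) {x : Finset (Fin n) → R} (hx : ∀ k, contract (g k) x = 0) :
    contractList (l.map g) (l.foldr (fun k y => wedge (u k) y) x) = Δ ^ l.length • x := by
  induction l with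
  | nil => simp
  | cons k l ih =>
    rw [List.nodup_cons] at hl
    rw [List.map_cons, List.foldr_cons, contractList_cons, contract_wedge, hu, if_pos rfl,
      contract_foldr_wedge hu hl.1 (hx k), map_zero, sub_zero, contractList_smul, ih hl.2,
      List.length_cons, pow_succ', mul_smul]

lemma foldr_wedge_eq_zero_of_card (u : Fin m → Fin n → R) {l : List (Fin m)}
    {x : Finset (Fin n) → R} {r : ℕ} (hx : ∀ S, x S ≠ 0 → S.card = r) (S : Finset (Fin n))
    (hS : l.foldr (fun k y => wedge (u k) y) x S ≠ 0) : S.card = r + l.length := by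
  induction l generalizing S with
  | nil => exact hx S hS
  | cons k l ih => exact wedge_eq_zero_of_card ih S hS

lemma exists_boundary_eq_pow_smul {g u : Fin m → Fin n → R} {Δ : R}
    (hu : ∀ l k, ∑ i, g l i * u k i = if l = k then Δ else 0) {i : ℕ} {z : Chain m n R}
    (hz : IsGraded i z) (hz0 : IsCycle g i z) :
    ∃ y, IsGraded (i + 1) y ∧ boundary g i y = Δ ^ m • z := by
  have hmap : (List.finRange m).map g = List.ofFn g := List.ofFn_eq_map.symm
  cases i with
  | zero =>
    refine ⟨fun a => (List.finRange m).foldr (fun k y => wedge (u k) y) (z a), fun a S h => ?_, ?_⟩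
    · have h2 := foldr_wedge_eq_zero_of_card u (fun T hT => (hz a T hT).2) S h
      rw [List.length_finRange] at h2
      refine ⟨?_, show S.card = m + 2 + 0 by omega⟩
      have h0 : z a ≠ 0 := fun h0 => by
        simp only [h0] at h
        have h3 := foldr_wedge_eq_zero_of_card u (l := List.finRange m)
          (x := (0 : Finset (Fin n) → R)) (r := S.card + 1) (fun T hT => absurd rfl hT) S h
        omega
      obtain ⟨T, hT⟩ := Function.ne_iff.mp h0
      simp [(hz a T hT).1]
    · ext a : 1
      rw [boundary_zero_apply, ← hmap,
        contractList_foldr_wedge hu (List.nodup_finRange m) fun k => hz0 k a, List.length_finRange]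
      rfl
  | succ i =>
    have hz1 : shiftContract g z = 0 := by
      cases i with
      | zero =>
        ext a : 1
        rw [shiftContract_apply]
        refine Finset.sum_eq_zero fun k _ => ?_
        have : z (a + Pi.single k 1) = 0 := by
          ext T
          by_contra hT
          have h1 : ∑ j, (a + Pi.single k 1 : Fin m → ℕ) j = 0 := (hz _ T hT).1
          simp [Finset.sum_add_distrib] at h1
        rw [this, map_zero]
      | succ i => exact hz0
    obtain ⟨-, -, y, hy, h⟩ := exists_pow_smul_eq_remainderList hu hz hz1 (List.finRange m)
    refine ⟨y, hy, ?_⟩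
    rw [List.length_finRange] at h
    change shiftContract g y = _
    rw [h, right_eq_add]
    ext a : 1
    by_cases ha : a = 0
    · subst ha
      rw [remainderList_apply_zero]
      cases i with
      | zero =>
        refine foldr_wedge_contract_eq_zero hu (List.nodup_finRange m) ?_
        rw [hmap]
        exact congrFun hz0 0
      | succ i =>
        have : z 0 = 0 := by
          ext T
          by_contra hT
          simpa using (hz 0 T hT).1
        rw [this]
        exact foldr_wedge_contract_eq_zero hu (List.nodup_finRange m) (contractList_zero _)
    · obtain ⟨k, hk⟩ := Function.ne_iff.mp ha
      exact remainderList_apply_of_ne_zero g u (List.mem_finRange k) z hk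

lemma exists_boundary_eq_det_pow_smul (g : Fin m → Fin n → R) (c : Fin m → Fin n) {i : ℕ}
    {z : Chain m n R} (hz : IsGraded i z) (hz0 : IsCycle g i z) :
    ∃ y, IsGraded (i + 1) y ∧
      boundary g i y = (Matrix.of fun i j => g i (c j)).det ^ m • z := by
  set M : Matrix (Fin m) (Fin m) R := Matrix.of fun i j => g i (c j) with hM
  refine exists_boundary_eq_pow_smul
    (u := fun k i => ∑ j, if c j = i then M.adjugate j k else 0) (fun l k => ?_) hz hz0
  have h1 := congrFun (congrFun (Matrix.mul_adjugate M) l) k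
  rw [Matrix.mul_apply, Matrix.smul_apply, Matrix.one_apply, smul_eq_mul, mul_ite, mul_one,
    mul_zero] at h1
  rw [← h1]
  simp only [Finset.mul_sum]
  rw [Finset.sum_comm]
  refine Finset.sum_congr rfl fun j _ => ?_
  rw [Finset.sum_eq_single (c j)]
  · simp [hM]
  · intro i _ hi
    rw [if_neg hi.symm, mul_zero]
  · simp

lemma exists_boundary_eq_pow_smul_of_mem_minorIdeal (g : Fin m → Fin n → R) {f : R}
    (hf : f ∈ minorIdeal g) {i : ℕ} {z : Chain m n R} (hz : IsGraded i z) (hz0 : IsCycle g i z) :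
    ∃ N : ℕ, ∃ y, IsGraded (i + 1) y ∧ boundary g i y = f ^ N • z := by
  let T : Ideal R :=
    { carrier := {r | ∃ y, IsGraded (i + 1) y ∧ boundary g i y = r • z}
      add_mem' := by
        rintro a b ⟨y, hy, hya⟩ ⟨y', hy', hyb⟩
        exact ⟨y + y', hy.add hy', by rw [map_add, hya, hyb, add_smul]⟩
      zero_mem' := ⟨0, fun a S h => absurd rfl h, by simp⟩
      smul_mem' := by
        rintro c a ⟨y, hy, hya⟩
        exact ⟨c • y, hy.smul c, by rw [map_smul, hya, smul_eq_mul, mul_smul]⟩ }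
  have hle : minorIdeal g ≤ T.radical := by
    rw [minorIdeal, Ideal.span_le]
    rintro _ ⟨c, rfl⟩
    exact ⟨m, exists_boundary_eq_det_pow_smul g c hz hz0⟩
  exact hle hf

/-! ### Acyclicity -/

lemma boundary_map {R' : Type*} [CommRing R'] (φ : R →+* R') (g : Fin m → Fin n → R) (i : ℕ)
    (z : Chain m n R) :
    boundary (fun k j => φ (g k j)) i (fun a S => φ (z a S)) = fun a S => φ (boundary g i z a S) := by
  ext a S
  cases i with
  | zero =>
    rw [boundary_zero_apply, boundary_zero_apply, ← contractList_map, List.map_ofFn]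
    rfl
  | succ i =>
    simp only [boundary]
    rw [shiftContract_apply, shiftContract_apply, Finset.sum_apply, Finset.sum_apply, map_sum]
    exact Finset.sum_congr rfl fun k _ => contract_map φ _ _ _

lemma minorIdeal_map {R' : Type*} [CommRing R'] (φ : R →+* R') (g : Fin m → Fin n → R) :
    minorIdeal (fun k j => φ (g k j)) = (minorIdeal g).map φ := by
  rw [minorIdeal, minorIdeal, Ideal.map_span, ← Set.range_comp]
  congr 2
  ext c
  rw [Function.comp_apply, RingHom.map_det]
  rfl

lemma exists_eq_smul_of_quotient_mk_eq_zero {i : ℕ} {z : Chain m n R} (hz : IsGraded i z) {f : R}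
    (h : ∀ a S, Ideal.Quotient.mk (Ideal.span {f}) (z a S) = 0) :
    ∃ x, IsGraded i x ∧ z = f • x := by
  have h' : ∀ a S, ∃ y, z a S = f * y := fun a S =>
    Ideal.mem_span_singleton.mp (Ideal.Quotient.eq_zero_iff_mem.mp (h a S))
  choose x hx using h'
  classical
  refine ⟨fun a S => if z a S = 0 then 0 else x a S, hz.of_eq_zero fun a S h0 => if_pos h0, ?_⟩
  ext a S
  by_cases h0 : z a S = 0
  · simp [h0]
  · simpa [h0] using hx a S

lemma exists_isGraded_lift {f : R} {i : ℕ} {z : Chain m n (R ⧸ Ideal.span {f})}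
    (hz : IsGraded i z) :
    ∃ w : Chain m n R, IsGraded i w ∧ ∀ a S, Ideal.Quotient.mk (Ideal.span {f}) (w a S) = z a S := by
  have h' : ∀ a S, ∃ y, Ideal.Quotient.mk (Ideal.span {f}) y = z a S := fun a S =>
    Ideal.Quotient.mk_surjective _
  choose w hw using h'
  classical
  refine ⟨fun a S => if z a S = 0 then 0 else w a S, ?_, fun a S => ?_⟩
  · cases i <;> exact fun a S h => hz a S fun h0 => h (if_pos h0)
  · by_cases h0 : z a S = 0
    · simp [h0]
    · simpa [h0] using hw a S

lemma IsGraded.map {R' : Type*} [CommRing R'] (φ : R →+* R') {i : ℕ} {z : Chain m n R}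
    (hz : IsGraded i z) : IsGraded i (fun a S => φ (z a S)) := by
  cases i <;> exact fun a S h => hz a S fun h0 => h (by simp [h0])

lemma exactAt_of_quotient {g : Fin m → Fin n → R} {f : R} (hf : IsSMulRegular R f)
    (hfg : f ∈ minorIdeal g) {i : ℕ}
    (hq : ExactAt (fun k j => Ideal.Quotient.mk (Ideal.span {f}) (g k j)) (i + 1)) :
    ExactAt g i := by
  have hreg : IsSMulRegular (Chain m n R) f := IsSMulRegular.pi fun _ => IsSMulRegular.pi fun _ => hf
  have key : ∀ z, IsGraded i z → (∃ y, IsGraded (i + 1) y ∧ boundary g i y = f • z) →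
      ∃ y, IsGraded (i + 1) y ∧ boundary g i y = z := by
    rintro z hz ⟨y, hy, hyz⟩
    obtain ⟨w', hw', hwy⟩ := hq _ (hy.map (Ideal.Quotient.mk (Ideal.span {f}))) (by
      change boundary _ i _ = 0
      rw [boundary_map, hyz]
      ext a S
      simp)
    obtain ⟨w, hw, hww'⟩ := exists_isGraded_lift hw'
    obtain ⟨x, hx, hx'⟩ := exists_eq_smul_of_quotient_mk_eq_zero (f := f)
      (hy.add (hw.boundary g).neg) (fun a S => by
        have h1 : w' = fun a S => Ideal.Quotient.mk (Ideal.span {f}) (w a S) := by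
          ext a S
          rw [hww']
        rw [h1, boundary_map] at hwy
        have h2 := congrFun (congrFun hwy a) S
        simp only [Pi.add_apply, Pi.neg_apply, map_add, map_neg]
        rw [h2, add_neg_cancel])
    refine ⟨x, hx, hreg ?_⟩
    change f • _ = f • _
    rw [← map_smul, ← hx', map_add, map_neg, boundary_boundary, neg_zero, add_zero, hyz]
  intro z hz hz0
  obtain ⟨N, hN⟩ := exists_boundary_eq_pow_smul_of_mem_minorIdeal g hfg hz hz0
  induction N with
  | zero => simpa using hN
  | succ N ih =>
    refine ih (key _ (hz.smul _) ?_)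
    simpa [pow_succ', mul_smul] using hN

/-- Acyclicity of the generalized Koszul complex in presence of a regular sequence of maximal
minors of length `n - m`. -/
theorem exactAt_of_isWeaklyRegular {R : Type*} [CommRing R] (hmn : m < n) (l : List R)
    (g : Fin m → Fin n → R) (hl : RingTheory.Sequence.IsWeaklyRegular R l)
    (hlg : ∀ f ∈ l, f ∈ minorIdeal g) (i : ℕ) (hi : n ≤ m + i + l.length) : ExactAt g i := by
  induction hlen : l.length generalizing R i with
  | zero =>
    obtain ⟨j, rfl⟩ : ∃ j, i = j + 1 := ⟨i - 1, by omega⟩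
    intro z hz _
    refine ⟨0, fun a S h => absurd rfl h, ?_⟩
    rw [map_zero, hz.eq_zero_of_le (by omega)]
  | succ d ih =>
    obtain ⟨f, l, rfl⟩ := List.exists_cons_of_length_eq_add_one hlen
    rw [List.length_cons] at hi hlen
    rw [RingTheory.Sequence.isWeaklyRegular_cons_iff] at hl
    refine exactAt_of_quotient hl.1 (hlg f List.mem_cons_self) ?_
    refine ih (l.map (Ideal.Quotient.mk (Ideal.span {f}))) _ ?_ ?_ _ ?_ ?_
    · refine (RingTheory.Sequence.isWeaklyRegular_map_algebraMap_iff _ _ l).mpr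
        ((LinearEquiv.isWeaklyRegular_congr (Submodule.quotEquivOfEq _ _ ?_) _).mp hl.2)
      rw [← Submodule.ideal_span_singleton_smul, smul_eq_mul, Ideal.mul_top]
    · intro f' hf'
      obtain ⟨f'', hf'', rfl⟩ := List.mem_map.mp hf'
      rw [minorIdeal_map]
      exact Ideal.mem_map_of_mem _ (hlg f'' (List.mem_cons_of_mem _ hf''))
    · rw [List.length_map]
      omega
    · rw [List.length_map]
      omega

end Complex

section RegularSequence

open RingTheory.Sequence CategoryTheory Abelian Limits Pointwise

lemma isSMulRegular_quotient_map_C_of_monic {S : Type*} [CommRing S] (I : Ideal S)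
    {q : Polynomial S} (hq : q.Monic) :
    IsSMulRegular (Polynomial S ⧸ I.map Polynomial.C) q := by
  rw [isSMulRegular_quotient_iff_mem_of_smul_mem]
  intro p hp
  have key : ∀ p : Polynomial S, p ∈ I.map (Polynomial.C : S →+* Polynomial S) ↔
      p.map (Ideal.Quotient.mk I) = 0 := fun p => by
    rw [Ideal.mem_map_C_iff, Polynomial.ext_iff]
    simp [Ideal.Quotient.eq_zero_iff_mem]
  rw [smul_eq_mul, key, Polynomial.map_mul] at hp
  rw [key]
  exact ((hq.map _).mul_right_eq_zero_iff).mp hp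

/-- Monic polynomials in the different variables form a regular sequence. -/
lemma exists_isWeaklyRegular_of_monic {R : Type*} [CommRing R] {n : ℕ} (q : Fin n → Polynomial R)
    (hq : ∀ i, (q i).Monic) :
    ∃ l : List (MvPolynomial (Fin n) R), l.length = n ∧
      (∀ f ∈ l, ∃ i, f = Polynomial.aeval (X i) (q i)) ∧
      IsWeaklyRegular (MvPolynomial (Fin n) R) l := by
  induction n with
  | zero => exact ⟨[], rfl, by simp, IsWeaklyRegular.nil _ _⟩
  | succ n ih =>
    obtain ⟨l, hlen, hl, hreg⟩ := ih (fun i => q i.succ) fun i => hq i.succ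
    have h1 : IsWeaklyRegular (Polynomial (MvPolynomial (Fin n) R))
        (l.map (algebraMap (MvPolynomial (Fin n) R) (Polynomial (MvPolynomial (Fin n) R))) ++
          [(q 0).map C]) := by
      rw [isWeaklyRegular_append_iff, isWeaklyRegular_singleton_iff]
      refine ⟨hreg.of_flat, ?_⟩
      have h2 := isSMulRegular_quotient_map_C_of_monic (Ideal.ofList l) ((hq 0).map
        (C : R →+* MvPolynomial (Fin n) R))
      refine (LinearEquiv.isSMulRegular_congr (Submodule.quotEquivOfEq _ _ ?_) _).mp h2
      rw [smul_eq_mul, Ideal.mul_top, ← Ideal.map_ofList]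
      rfl
    let e := (finSuccEquiv R n).symm
    refine ⟨(l.map (algebraMap (MvPolynomial (Fin n) R) (Polynomial (MvPolynomial (Fin n) R))) ++
      [(q 0).map C]).map e, by simp [hlen], ?_, ?_⟩
    · intro f hf
      simp only [List.map_append, List.map_map, List.map_cons, List.map_nil, List.mem_append,
        List.mem_map, List.mem_singleton] at hf
      rcases hf with ⟨f, hf, rfl⟩ | rfl
      · obtain ⟨i, rfl⟩ := hl f hf
        refine ⟨i.succ, ?_⟩
        have h3 := Polynomial.aeval_algHom_apply (e.toAlgHom.comp (IsScalarTower.toAlgHom R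
          (MvPolynomial (Fin n) R) (Polynomial (MvPolynomial (Fin n) R)))) (X i) (q i.succ)
        refine h3.symm.trans ?_
        congr 2
        exact (AlgEquiv.symm_apply_eq _).mpr finSuccEquiv_X_succ.symm
      · refine ⟨0, (AlgEquiv.symm_apply_eq _).mpr ?_⟩
        have h3 := Polynomial.aeval_algHom_apply (finSuccEquiv R n).toAlgHom (X 0) (q 0)
        refine Eq.trans ?_ h3
        rw [show (finSuccEquiv R n).toAlgHom (X 0) = Polynomial.X from finSuccEquiv_X_zero]
        exact (Polynomial.aeval_X_left_eq_map _).symm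
    · refine (AddEquiv.isWeaklyRegular_congr (e := e.toAddEquiv) ?_).mp h1
      rw [List.forall₂_map_right_iff, List.forall₂_same]
      intro r _ x
      exact map_mul e r x

lemma exists_isRegular_quotient_of_subsingleton_ext {R : Type} [CommRing R] [IsNoetherianRing R]
    (I : Ideal R) (k : ℕ) (l : List R) (hlI : ∀ f ∈ l, f ∈ I) (hlk : l.length ≤ k)
    (M : ModuleCat.{0} R) [Module.Finite R M] (hM : I • (⊤ : Submodule R M) ≠ ⊤)
    (hl : IsWeaklyRegular M l)
    (hext : ∀ i < k, Subsingleton (Ext (ModuleCat.of R (Shrink.{0} (R ⧸ I))) M i)) :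
    ∃ rs : List R, rs.length = k - l.length ∧ (∀ r ∈ rs, r ∈ I) ∧
      IsRegular (M ⧸ Ideal.ofList l • (⊤ : Submodule R M)) rs := by
  induction l generalizing M k with
  | nil =>
    obtain ⟨rs, h1, h2, h3⟩ := ((ModuleCat.exists_isRegular_tfae I k M hM.lt_top).out 1 3).mp hext
    refine ⟨rs, h1, h2, (LinearEquiv.isRegular_congr (Submodule.quotEquivOfEqBot _ ?_) _).mpr h3⟩
    simp
  | cons f l ih =>
    rw [isWeaklyRegular_cons_iff] at hl
    rw [List.length_cons] at hlk
    have hfI := hlI f List.mem_cons_self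
    have hM' : I • (⊤ : Submodule R (QuotSMulTop f M)) ≠ ⊤ := fun h => by
      refine hM ?_
      have := congrArg (Submodule.comap (Submodule.mkQ _)) h
      simpa [Submodule.comap_smul_top_of_surjective I _ (Submodule.mkQ_surjective _),
        Submodule.smul_mono_left ((Ideal.span_singleton_le_iff_mem I).mpr hfI),
        ← Submodule.ideal_span_singleton_smul] using this
    have hext' : ∀ i < k - 1, Subsingleton (Ext (ModuleCat.of R (Shrink.{0} (R ⧸ I)))
        (ModuleCat.of R (QuotSMulTop f M)) i) := fun i hi => by
      have zero1 := AddCommGrpCat.isZero_of_iff_subsingleton.mpr (hext i (by omega))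
      have zero2 := AddCommGrpCat.isZero_of_iff_subsingleton.mpr (hext (i + 1) (by omega))
      exact AddCommGrpCat.subsingleton_of_isZero <| ShortComplex.Exact.isZero_of_both_zeros
        ((Ext.covariant_sequence_exact₃' _ hl.1.smulShortComplex_shortExact) i (i + 1) rfl)
        (zero1.eq_zero_of_src _) (zero2.eq_zero_of_tgt _)
    obtain ⟨rs, h1, h2, h3⟩ := ih (k - 1) (fun f' hf' => hlI f' (List.mem_cons_of_mem _ hf'))
      (by omega) (ModuleCat.of R (QuotSMulTop f M)) hM' hl.2 hext'
    exact ⟨rs, by rw [h1, List.length_cons]; omega, h2,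
      (LinearEquiv.isRegular_congr
        (Submodule.quotOfListConsSMulTopEquivQuotSMulTopInner M f l) _).mpr h3⟩

/-- A zero-dimensional ideal containing a regular sequence of length `m` contains elements
forming a regular sequence of length `n - m` modulo the given one. -/
lemma exists_isWeaklyRegular_quotient_of_finiteDimensional {n : ℕ}
    (K : Ideal (MvPolynomial (Fin n) ℂ)) (hK : FiniteDimensional ℂ (MvPolynomial (Fin n) ℂ ⧸ K))
    (l : List (MvPolynomial (Fin n) ℂ)) (hl : IsWeaklyRegular (MvPolynomial (Fin n) ℂ) l)
    (hln : l.length ≤ n) (hlK : ∀ f ∈ l, f ∈ K) (hK1 : K ≠ ⊤) :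
    ∃ rs : List (MvPolynomial (Fin n) ℂ), rs.length = n - l.length ∧ (∀ r ∈ rs, r ∈ K) ∧
      IsWeaklyRegular (MvPolynomial (Fin n) ℂ ⧸ Ideal.ofList l) rs := by
  have hint : ∀ i : Fin n, IsIntegral ℂ (Ideal.Quotient.mk K (X i)) := fun i =>
    Algebra.IsIntegral.isIntegral _
  choose q hq hq0 using hint
  have hqK : ∀ i, Polynomial.aeval (X i) (q i) ∈ K := fun i => by
    rw [← Ideal.Quotient.eq_zero_iff_mem, ← Ideal.Quotient.mkₐ_eq_mk ℂ,
      ← Polynomial.aeval_algHom_apply]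
    exact hq0 i
  obtain ⟨fs, hfs, hfs', hreg⟩ := exists_isWeaklyRegular_of_monic q hq
  have hfsK : ∀ f ∈ fs, f ∈ K := fun f hf => by
    obtain ⟨i, rfl⟩ := hfs' f hf
    exact hqK i
  have hM : K • (⊤ : Submodule (MvPolynomial (Fin n) ℂ) (MvPolynomial (Fin n) ℂ)) ≠ ⊤ := by
    rwa [smul_eq_mul, Ideal.mul_top]
  have hfs1 : ∃ rs : List (MvPolynomial (Fin n) ℂ), rs.length = n ∧ (∀ r ∈ rs, r ∈ K) ∧
      IsRegular (ModuleCat.of (MvPolynomial (Fin n) ℂ) (MvPolynomial (Fin n) ℂ)) rs :=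
    ⟨fs, hfs, hfsK, hreg, fun h => hM (top_le_iff.mp (h.trans_le (Submodule.smul_mono_left
      (Ideal.span_le.mpr hfsK))))⟩
  have hext := ((ModuleCat.exists_isRegular_tfae K n
    (ModuleCat.of (MvPolynomial (Fin n) ℂ) (MvPolynomial (Fin n) ℂ)) hM.lt_top).out 1 3).mpr hfs1
  obtain ⟨rs, h1, h2, h3⟩ :=
    exists_isRegular_quotient_of_subsingleton_ext K n l hlK hln _ hM hl hext
  refine ⟨rs, h1, h2, (LinearEquiv.isWeaklyRegular_congr (Submodule.quotEquivOfEq _ _ ?_) _).mp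
    h3.toIsWeaklyRegular⟩
  exact (smul_eq_mul _ _).trans (Ideal.mul_top _)

end RegularSequence

section PoissonBrackets

/-- The bivector with given antisymmetric coefficients. -/
lemma exists_bivector {n : ℕ} {R : Type*} [CommRing R] {c : R} (hc : c + c = 1)
    {π : Fin n → Fin n → R} (hπ : ∀ i j, π i j = -π j i) :
    ∃ ω : Finset (Fin n) → R, (∀ S, ω S ≠ 0 → S.card = 2) ∧
      ∀ u, contract u ω = wedge (fun j => ∑ i, u i * π i j) (Pi.single ∅ 1) := by
  have h0 : ∀ S, (Pi.single ∅ 1 : Finset (Fin n) → R) S ≠ 0 → S.card = 0 := fun S hS => by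
    by_contra hne
    exact hS (Pi.single_eq_of_ne (fun h => hne (by rw [h, Finset.card_empty])) _)
  have h0' : ∀ u : Fin n → R, contract u (Pi.single ∅ 1 : Finset (Fin n) → R) = 0 := fun u => by
    ext S
    rw [contract_apply, Finset.sum_apply]
    refine Finset.sum_eq_zero fun i _ => ?_
    simp [basisContract_apply, Finset.insert_ne_empty]
  have hu : ∀ u i, contract u (wedge (Pi.single i c) (wedge (π i) (Pi.single ∅ 1))) =
      (u i * c) • wedge (π i) (Pi.single ∅ 1) -
        (c * ∑ j, u j * π i j) • wedge (Pi.single i 1) (Pi.single ∅ 1) := fun u i => by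
    have h1 : ∀ x : Finset (Fin n) → R,
        wedge (Pi.single i c) x = c • wedge (Pi.single i 1) x := fun x => by
      rw [wedge_apply, wedge_apply, Finset.smul_sum]
      refine Finset.sum_congr rfl fun j _ => ?_
      by_cases hj : j = i
      · subst hj
        simp
      · simp [hj]
    have h2 : ∑ j, u j * (Pi.single i c : Fin n → R) j = u i * c := by
      rw [Finset.sum_eq_single i] <;> simp +contextual
    rw [contract_wedge, contract_wedge, h0', map_zero, sub_zero, h1, map_smul, smul_smul, h2]
  refine ⟨∑ i, wedge (Pi.single i c) (wedge (π i) (Pi.single ∅ 1)), fun S hS => ?_, fun u => ?_⟩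
  · rw [Finset.sum_apply] at hS
    obtain ⟨i, -, hi⟩ := Finset.exists_ne_zero_of_sum_ne_zero hS
    exact wedge_eq_zero_of_card (wedge_eq_zero_of_card h0) S hi
  · have hs : ∀ i, wedge (Pi.single i 1) (Pi.single ∅ 1 : Finset (Fin n) → R) =
        basisWedge i (Pi.single ∅ 1) := fun i => by
      rw [wedge_apply, Finset.sum_eq_single i] <;> simp +contextual
    simp only [map_sum, hu, hs]
    simp only [wedge_apply, Finset.smul_sum, smul_smul, Finset.mul_sum, Finset.sum_smul,
      Finset.sum_sub_distrib]
    rw [Finset.sum_comm, ← Finset.sum_sub_distrib]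
    refine Finset.sum_congr rfl fun j _ => ?_
    rw [← Finset.sum_sub_distrib]
    refine Finset.sum_congr rfl fun i _ => ?_
    rw [← sub_smul, hπ j i]
    congr 1
    linear_combination (u i * π i j) * hc

lemma wedge_single_empty_eq_sum {n : ℕ} {R : Type*} [CommRing R] (u v : Fin n → R) :
    contract v (wedge u (Pi.single ∅ 1)) ∅ = ∑ j, v j * u j := by
  rw [contract_wedge, Pi.sub_apply, Pi.smul_apply, wedge_apply, Finset.sum_apply]
  simp [basisWedge_apply]

/-- Any antisymmetric bivector killed by the rows of `g` is a contraction of an alternating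
`(m + 2)`-vector with the rows of `g`, if the generalized Koszul complex of `g` is exact. -/
theorem ExactAt.exists_alternating {m n : ℕ} {R : Type*} [CommRing R] {g : Fin m → Fin n → R}
    (hg : ExactAt g 0) {c : R} (hc : c + c = 1) {π : Fin n → Fin n → R}
    (hπ : ∀ i j, π i j = -π j i) (hπg : ∀ k j, ∑ i, g k i * π i j = 0) :
    ∃ p : (Fin (m + 2) → Fin n) → R,
      (∀ (σ : Equiv.Perm (Fin (m + 2))) (v : Fin (m + 2) → Fin n),
        p (v ∘ σ) = (Equiv.Perm.sign σ : ℤ) • p v) ∧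
      ∀ u v : Fin n → R, ∑ i, ∑ j, u i * v j * π i j =
        ∑ w : Fin (m + 2) → Fin n, p w * (u (w 0) * v (w 1) * ∏ t : Fin m, g t (w t.succ.succ)) := by
  obtain ⟨ω, hω, hωu⟩ := exists_bivector hc hπ
  obtain ⟨y, -, hy⟩ := hg (Pi.single 0 ω)
    (fun a S haS => by
      by_cases ha : a = 0
      · subst ha
        exact ⟨rfl, hω S (by simpa using haS)⟩
      · simp [ha] at haS)
    (fun k a => by
      by_cases ha : a = 0
      · subst ha
        rw [Pi.single_eq_same, hωu, wedge_apply]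
        simp [hπg]
      · rw [Pi.single_eq_of_ne ha, map_zero])
  have hy0 : contractList (List.ofFn g) (y 0) = ω := by
    rw [← boundary_zero_apply, hy, Pi.single_eq_same]
  refine ⟨fun w => contractList (List.ofFn fun t => Pi.single (w t) 1) (y 0) ∅, fun σ w => ?_,
    fun u v => ?_⟩
  · have h1 := contractList_ofFn_comp_perm σ (fun t => (Pi.single (w t) 1 : Fin n → R)) (y 0)
    exact congrFun h1 ∅
  · have h1 := contractList_ofFn_eq_sum (Fin.cons u (Fin.cons v g) : Fin (m + 2) → Fin n → R) (y 0)
    have h2 : contractList (List.ofFn (Fin.cons u (Fin.cons v g) : Fin (m + 2) → Fin n → R)) (y 0) =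
        contract v (contract u ω) := by
      rw [List.ofFn_cons, List.ofFn_cons, contractList_cons, contractList_cons,
        contractList_contract_contract, hy0]
    rw [h2, hωu] at h1
    have h3 := congrFun h1 ∅
    rw [wedge_single_empty_eq_sum, Finset.sum_apply] at h3
    calc ∑ i, ∑ j, u i * v j * π i j = ∑ j, v j * ∑ i, u i * π i j := by
          rw [Finset.sum_comm]
          refine Finset.sum_congr rfl fun j _ => ?_
          rw [Finset.mul_sum]
          exact Finset.sum_congr rfl fun i _ => by ring
      _ = _ := h3.trans (Finset.sum_congr rfl fun w _ => by
          rw [Pi.smul_apply, smul_eq_mul, mul_comm, Fin.prod_univ_succ, Fin.prod_univ_succ]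
          simp only [Fin.cons_zero, Fin.cons_succ]
          rw [← Fin.succ_zero_eq_one]
          ring)

/-- Alternating families lift along surjections from a `ℂ`-algebra. -/
lemma exists_alternating_lift {A R ι : Type*} [CommRing A] [CommRing R] [Algebra ℂ A]
    (φ : A →+* R) (hφ : Function.Surjective φ) {r : ℕ} (p : (Fin r → ι) → R)
    (hp : ∀ (σ : Equiv.Perm (Fin r)) v, p (v ∘ σ) = (Equiv.Perm.sign σ : ℤ) • p v) :
    ∃ q : (Fin r → ι) → A,
      (∀ (σ : Equiv.Perm (Fin r)) v, q (v ∘ σ) = (Equiv.Perm.sign σ : ℤ) • q v) ∧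
      ∀ v, φ (q v) = p v := by
  choose s hs using hφ
  let c : A := algebraMap ℂ A ((r.factorial : ℂ)⁻¹)
  have hc : c * (r.factorial : A) = 1 := by
    rw [← map_natCast (algebraMap ℂ A), ← map_mul,
      inv_mul_cancel₀ (Nat.cast_ne_zero.mpr r.factorial_ne_zero), map_one]
  have hsign : ∀ σ : Equiv.Perm (Fin r), (Equiv.Perm.sign σ : ℤ) * (Equiv.Perm.sign σ : ℤ) = 1 :=
    fun σ => by rw [← Units.val_mul, Int.units_mul_self, Units.val_one]
  refine ⟨fun v => c * ∑ τ : Equiv.Perm (Fin r), (Equiv.Perm.sign τ : ℤ) • s (p (v ∘ τ)),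
    fun σ v => ?_, fun v => ?_⟩
  · beta_reduce
    rw [← mul_smul_comm, Finset.smul_sum, ← Equiv.sum_comp (Equiv.mulLeft σ⁻¹)
      fun τ : Equiv.Perm (Fin r) => (Equiv.Perm.sign τ : ℤ) • s (p ((v ∘ σ) ∘ τ))]
    congr 1
    refine Finset.sum_congr rfl fun τ _ => ?_
    have h1 : (v ∘ σ) ∘ ((Equiv.mulLeft σ⁻¹) τ) = v ∘ τ := by
      ext t
      simp
    rw [h1, smul_smul]
    simp
  · have h1 : ∀ τ : Equiv.Perm (Fin r), φ ((Equiv.Perm.sign τ : ℤ) • s (p (v ∘ τ))) = p v :=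
      fun τ => by rw [map_zsmul, hs, hp, smul_smul, hsign, one_smul]
    rw [map_mul, map_sum, Finset.sum_congr rfl fun τ _ => h1 τ, Finset.sum_const,
      Finset.card_univ, Fintype.card_perm, Fintype.card_fin, nsmul_eq_mul, ← mul_assoc,
      ← map_natCast φ, ← map_mul, hc, map_one, one_mul]

lemma eq_sum_pderiv_of_leibniz {n : ℕ} {R : Type*} [CommRing R]
    (φ : MvPolynomial (Fin n) ℂ →+* R) (d : MvPolynomial (Fin n) ℂ → R)
    (hadd : ∀ F G, d (F + G) = d F + d G) (hC : ∀ c, d (C c) = 0)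
    (hmul : ∀ F G, d (F * G) = d F * φ G + φ F * d G) (F : MvPolynomial (Fin n) ℂ) :
    d F = ∑ i, φ (pderiv i F) * d (X i) := by
  induction F using MvPolynomial.induction_on with
  | C c => simp [hC]
  | add F G hF hG => simp only [hadd, hF, hG, map_add, add_mul, Finset.sum_add_distrib]
  | mul_X F j hF =>
    have h1 : ∑ i, φ (F * pderiv i (X j)) * d (X i) = φ F * d (X j) := by
      rw [Finset.sum_eq_single j]
      · simp
      · intro i _ hij
        rw [pderiv_X_of_ne hij.symm]
        simp
      · simp
    simp only [pderiv_mul, map_add, add_mul, Finset.sum_add_distrib, h1]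
    rw [hmul, hF, Finset.sum_mul]
    congr 1
    refine Finset.sum_congr rfl fun i _ => ?_
    rw [map_mul]
    ring

lemma _root_.IsPoissonBracket.map_zero_left {R : Type*} [CommRing R] [Algebra ℂ R]
    {br : R → R → R} (hbr : IsPoissonBracket br) (k : R) : br 0 k = 0 := by
  have := hbr.1 1 0 0 k
  simpa using this

lemma _root_.IsPoissonBracket.map_add_left {R : Type*} [CommRing R] [Algebra ℂ R]
    {br : R → R → R} (hbr : IsPoissonBracket br) (f g k : R) :
    br (f + g) k = br f k + br g k := by
  simpa using hbr.1 1 f g k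

lemma _root_.IsPoissonBracket.map_algebraMap_left {R : Type*} [CommRing R] [Algebra ℂ R]
    {br : R → R → R} (hbr : IsPoissonBracket br) (c : ℂ) (k : R) :
    br (algebraMap ℂ R c) k = 0 := by
  have h1 : br 1 k = 0 := by simpa using hbr.2.2.2.2.1 1 1 k
  have h2 := hbr.1 c 1 0 k
  rwa [add_zero, h1, hbr.map_zero_left, smul_zero, add_zero, ← Algebra.algebraMap_eq_smul_one] at h2

lemma _root_.IsPoissonBracket.eq_sum_pderiv_left {n : ℕ} {R : Type*} [CommRing R] [Algebra ℂ R]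
    {br : R → R → R} (hbr : IsPoissonBracket br) (φ : MvPolynomial (Fin n) ℂ →ₐ[ℂ] R)
    (F : MvPolynomial (Fin n) ℂ) (k : R) :
    br (φ F) k = ∑ i, φ (pderiv i F) * br (φ (X i)) k := by
  refine eq_sum_pderiv_of_leibniz (φ : MvPolynomial (Fin n) ℂ →+* R) (fun F => br (φ F) k)
    (fun F G => ?_) (fun c => ?_) (fun F G => ?_) F
  · simp only [map_add, hbr.map_add_left]
  · simp only [← MvPolynomial.algebraMap_eq, AlgHom.commutes, hbr.map_algebraMap_left]
  · simp only [map_mul, hbr.2.2.2.2.1, RingHom.coe_coe]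

lemma _root_.IsPoissonBracket.eq_sum_pderiv {n : ℕ} {R : Type*} [CommRing R] [Algebra ℂ R]
    {br : R → R → R} (hbr : IsPoissonBracket br) (φ : MvPolynomial (Fin n) ℂ →ₐ[ℂ] R)
    (F G : MvPolynomial (Fin n) ℂ) :
    br (φ F) (φ G) =
      ∑ i, ∑ j, φ (pderiv i F) * φ (pderiv j G) * br (φ (X i)) (φ (X j)) := by
  rw [hbr.eq_sum_pderiv_left]
  refine Finset.sum_congr rfl fun i _ => ?_
  rw [hbr.2.2.1, hbr.eq_sum_pderiv_left, mul_neg, Finset.mul_sum, ← Finset.sum_neg_distrib]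
  refine Finset.sum_congr rfl fun j _ => ?_
  rw [hbr.2.2.1 (φ (X j))]
  ring

/-- Over an isolated complete intersection singularity the generalized Koszul complex of the
Jacobian matrix is exact at the bivectors. -/
theorem exactAt_jacobian {m n : ℕ} (hmn : m < n) (h : Fin m → MvPolynomial (Fin n) ℂ)
    (hreg : RingTheory.Sequence.IsWeaklyRegular (MvPolynomial (Fin n) ℂ) (List.ofFn h))
    (hsing : FiniteDimensional ℂ
      (MvPolynomial (Fin n) ℂ ⧸ (Ideal.span (Set.range h) ⊔
        minorIdeal fun i j => pderiv j (h i)))) :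
    ExactAt (fun k i => Ideal.Quotient.mk (Ideal.span (Set.range h)) (pderiv i (h k))) 0 := by
  set I := Ideal.span (Set.range h) with hI
  set K := I ⊔ minorIdeal fun i j => pderiv j (h i) with hK
  have hIl : Ideal.ofList (List.ofFn h) = I := by
    rw [hI, Ideal.ofList]
    congr 1
    ext f
    simp [List.mem_ofFn]
  have hKg : ∀ f ∈ K, Ideal.Quotient.mk I f ∈
      minorIdeal fun k i => Ideal.Quotient.mk I (pderiv i (h k)) := fun f hf => by
    rw [minorIdeal_map (Ideal.Quotient.mk I) fun k i => pderiv i (h k)]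
    have h1 := Ideal.mem_map_of_mem (Ideal.Quotient.mk I) hf
    rwa [hK, Ideal.map_sup, Ideal.map_quotient_self, bot_sup_eq] at h1
  by_cases hK1 : K = ⊤
  · intro z hz hz0
    have h1 := hKg 1 (hK1 ▸ Submodule.mem_top)
    rw [map_one] at h1
    obtain ⟨N, y, hy, hyz⟩ := exists_boundary_eq_pow_smul_of_mem_minorIdeal _ h1 hz hz0
    exact ⟨y, hy, by rw [hyz, one_pow, one_smul]⟩
  · obtain ⟨rs, hlen, hrK, hrs⟩ := exists_isWeaklyRegular_quotient_of_finiteDimensional K hsing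
      (List.ofFn h) hreg (by rw [List.length_ofFn]; exact hmn.le) (fun f hf => by
        obtain ⟨i, rfl⟩ := (List.mem_ofFn' _ _).mp hf
        exact le_sup_left (a := I) (Ideal.subset_span ⟨i, rfl⟩)) hK1
    rw [hIl] at hrs
    refine exactAt_of_isWeaklyRegular hmn
      (rs.map (algebraMap (MvPolynomial (Fin n) ℂ) (MvPolynomial (Fin n) ℂ ⧸ I))) _
      ((RingTheory.Sequence.isWeaklyRegular_map_algebraMap_iff _ _ _).mpr hrs) (fun f hf => ?_) 0 ?_
    · obtain ⟨r, hr, rfl⟩ := List.mem_map.mp hf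
      exact hKg r (hrK r hr)
    · rw [List.length_map, hlen, List.length_ofFn]
      omega

end PoissonBrackets

end ReducedForm

theorem poisson_bracket_reduced_form_complete_intersection
    (n m : ℕ) (hmn : m < n) (hcodim : 2 ≤ n - m)
    (h : Fin m → MvPolynomial (Fin n) ℂ)
    -- `h₁, …, hₘ` is a regular sequence
    (hreg : RingTheory.Sequence.IsRegular (MvPolynomial (Fin n) ℂ) (List.ofFn h))
    -- the complete intersection `h₁ = ⋯ = hₘ = 0` has isolated singularities:
    -- `A ⧸ ((h₁,…,hₘ) + J)` is finite dimensional over `ℂ`, where `J` is generated by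
    -- the `m × m` minors of the Jacobian matrix `(∂ⱼhᵢ)`
    (hsing : FiniteDimensional ℂ
      ((MvPolynomial (Fin n) ℂ) ⧸
        (Ideal.span (Set.range h) ⊔
          Ideal.span (Set.range fun c : Fin m → Fin n =>
            (Matrix.of fun i j => pderiv (c j) (h i)).det))))
    (br : (MvPolynomial (Fin n) ℂ ⧸ Ideal.span (Set.range h)) →
      (MvPolynomial (Fin n) ℂ ⧸ Ideal.span (Set.range h)) →
      (MvPolynomial (Fin n) ℂ ⧸ Ideal.span (Set.range h)))
    (hbr : IsPoissonBracket br)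
    (P : Ideal (MvPolynomial (Fin n) ℂ ⧸ Ideal.span (Set.range h))) (hP : P.IsPrime) :
    ∃ p : (Fin (m + 2) → Fin n) →
        Localization.AtPrime (P.comap (Ideal.Quotient.mk (Ideal.span (Set.range h)))),
      -- `p` is alternating under permutations of its `m + 2` indices
      (∀ (σ : Equiv.Perm (Fin (m + 2))) (v : Fin (m + 2) → Fin n),
        p (v ∘ σ) = (Equiv.Perm.sign σ : ℤ) • p v) ∧
      -- reduced form of the Poisson bracket after localization at `P`
      (∀ F G : MvPolynomial (Fin n) ℂ,
        algebraMap _ (Localization.AtPrime P)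
            (br (Ideal.Quotient.mk (Ideal.span (Set.range h)) F)
              (Ideal.Quotient.mk (Ideal.span (Set.range h)) G)) =
          ∑ v : Fin (m + 2) → Fin n,
            Localization.localRingHom
                (P.comap (Ideal.Quotient.mk (Ideal.span (Set.range h)))) P
                (Ideal.Quotient.mk (Ideal.span (Set.range h))) rfl (p v) *
              algebraMap _ (Localization.AtPrime P)
                (Ideal.Quotient.mk (Ideal.span (Set.range h))
                  (pderiv (v 0) F * pderiv (v 1) G *
                    ∏ t : Fin m, pderiv (v t.succ.succ) (h t)))) := by
  have hex := ReducedForm.exactAt_jacobian hmn h hreg.toIsWeaklyRegular hsing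
  let φ := Ideal.Quotient.mkₐ ℂ (Ideal.span (Set.range h))
  have hφh : ∀ k, φ (h k) = 0 := fun k =>
    Ideal.Quotient.eq_zero_iff_mem.mpr (Ideal.subset_span ⟨k, rfl⟩)
  obtain ⟨p, hp, hpbr⟩ := hex.exists_alternating (c := algebraMap ℂ _ (1 / 2))
    (by rw [← map_add, add_halves, map_one])
    (π := fun i j => br (φ (X i)) (φ (X j))) (fun i j => hbr.2.2.1 _ _)
    (fun k j => by
      rw [← hbr.map_zero_left (φ (X j)), ← hφh k, hbr.eq_sum_pderiv_left φ (h k)]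
      rfl)
  obtain ⟨q, hq, hqp⟩ := ReducedForm.exists_alternating_lift
    (Ideal.Quotient.mk (Ideal.span (Set.range h))) Ideal.Quotient.mk_surjective p hp
  refine ⟨fun v => algebraMap _ _ (q v), fun σ v => ?_, fun F G => ?_⟩
  · beta_reduce
    rw [hq, map_zsmul]
  · have h1 := (hbr.eq_sum_pderiv φ F G).trans
      (hpbr (fun i => φ (pderiv i F)) fun i => φ (pderiv i G))
    refine (congrArg (algebraMap _ (Localization.AtPrime P)) h1).trans ?_
    rw [map_sum]
    refine Finset.sum_congr rfl fun v _ => ?_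
    rw [Localization.localRingHom_to_map, hqp, map_mul (Ideal.Quotient.mk _),
      map_mul (Ideal.Quotient.mk _), map_prod (Ideal.Quotient.mk _)]
    exact map_mul _ _ _
end
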